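/- arXiv:1803.04005 — 5 statements merged into one kernel-verified Lean document; each statement's English description precedes it below -/
import Mathlib

section
/- Let n ≥ 2, d ≥ 3, and let F ∈ ℂ[e_1,…,e_n]_{n(d−2)} be a nonzero form such that the subspace F^⊥ ∩ ℂ[z_1,…,z_n]_{d−1} is n-dimensional and admits a basis f_1,…,f_n whose only common zero in ℂ^n is the origin. Then F is a nonzero scalar multiple of the associated form of 𝔣 = (f_1,…,f_n). In particular, every such F is the associated form of some n-tuple of degree d−1 forms whose only common zero is the origin. -/
open MvPolynomial

noncomputable section

/-- The partial derivative `∂/∂e_i` as a `ℂ`-linear endomorphism of `ℂ[e_1,…,e_n]`. -/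
def pdEnd (n : ℕ) (i : Fin n) : Module.End ℂ (MvPolynomial (Fin n) ℂ) :=
  (pderiv i).toLinearMap

/-- The polar pairing (apolarity action) `g ⋄ F := g(∂/∂e_1,…,∂/∂e_n) F`. -/
def diamond {n : ℕ} (g F : MvPolynomial (Fin n) ℂ) : MvPolynomial (Fin n) ℂ :=
  ∑ m ∈ g.support, g.coeff m • ((List.ofFn fun i => pdEnd n i ^ m i).prod F)

end
noncomputable section

/-- The Jacobian `det (∂f_i/∂z_j)` of an `n`-tuple of forms. -/
def jacPoly (n : ℕ) (f : Fin n → MvPolynomial (Fin n) ℂ) : MvPolynomial (Fin n) ℂ :=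
  Matrix.det (Matrix.of fun i j : Fin n => pderiv j (f i))

/-- `μ` is the system of coefficients defining the associated form of the tuple `𝔣`. -/
def IsAssocCoeffsT (n d : ℕ) (f : Fin n → MvPolynomial (Fin n) ℂ)
    (μ : (Fin n → ℕ) → ℂ) : Prop :=
  ∀ m : Fin n → ℕ, (∑ i, m i) = n * (d - 2) →
    (∏ i, X i ^ m i) - C (μ m) * jacPoly n f ∈ Ideal.span (Set.range f)

/-- The associated form built from the coefficients `μ`. -/
def assocForm (n d : ℕ) (μ : (Fin n → ℕ) → ℂ) : MvPolynomial (Fin n) ℂ :=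
  ∑ m ∈ Finset.Nat.antidiagonalTuple n (n * (d - 2)),
    C ((Nat.multinomial Finset.univ m : ℂ) * μ m) * ∏ i, X i ^ m i

end

namespace MvPolynomial

section Homogeneous

variable {σ R : Type*} [CommRing R]

attribute [local instance] MvPolynomial.gradedAlgebra

theorem homogeneousComponent_add_mul_of_isHomogeneous {f : MvPolynomial σ R} {a : ℕ}
    (hf : f.IsHomogeneous a) (k : ℕ) (p : MvPolynomial σ R) :
    homogeneousComponent (k + a) (p * f) = homogeneousComponent k p * f := by
  have h := DirectSum.coe_decompose_mul_add_of_right_mem (homogeneousSubmodule σ R)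
    (a := p) (i := k) ((mem_homogeneousSubmodule a f).2 hf)
  have e : ∀ (q : MvPolynomial σ R) (i : ℕ),
      (DirectSum.decompose (homogeneousSubmodule σ R) q i : MvPolynomial σ R) =
        homogeneousComponent i q := decomposition.decompose'_apply
  rwa [e, e] at h

theorem isHomogeneous_det {ι : Type*} [Fintype ι] [DecidableEq ι]
    {A : Matrix ι ι (MvPolynomial σ R)} {k : ℕ} (hA : ∀ i j, (A i j).IsHomogeneous k) :
    A.det.IsHomogeneous (Fintype.card ι * k) := by
  rw [Matrix.det_apply]
  refine IsHomogeneous.sum _ _ _ fun τ _ => ?_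
  rw [Units.smul_def, zsmul_eq_mul, ← map_intCast (C : R →+* MvPolynomial σ R)]
  refine IsHomogeneous.C_mul ?_ _
  have := IsHomogeneous.prod Finset.univ (fun i => A (τ i) i) (fun _ => k) fun i _ => hA _ _
  simpa using this

end Homogeneous

section Determinant

variable {ι R : Type*} [CommRing R] [Fintype ι] [DecidableEq ι]

theorem _root_.Matrix.det_mul_mem_of_mulVec_mem {J : Ideal R} {A : Matrix ι ι R} {v : ι → R}
    (h : ∀ i, A.mulVec v i ∈ J) (j : ι) : A.det * v j ∈ J := by
  have key : A.det • v = A.adjugate.mulVec (A.mulVec v) := by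
    rw [Matrix.mulVec_mulVec, Matrix.adjugate_mul, Matrix.smul_mulVec, Matrix.one_mulVec]
  have := congrFun key j
  simp only [Pi.smul_apply, smul_eq_mul] at this
  rw [this]
  exact J.sum_mem fun i _ => J.mul_mem_left _ (h i)

end Determinant

section PowerIdeal

variable {σ R : Type*} [CommRing R]

theorem mem_span_X_pow_image_iff {t : Set σ} {M : ℕ} {p : MvPolynomial σ R} :
    p ∈ Ideal.span ((fun i => (X i : MvPolynomial σ R) ^ M) '' t) ↔
      ∀ m ∈ p.support, ∃ i ∈ t, M ≤ m i := by
  have h := @mem_ideal_span_monomial_image σ R _ p ((fun i => Finsupp.single i M) '' t)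
  rw [Set.image_image] at h
  simpa [X_pow_eq_monomial, Finsupp.single_le_iff] using h

theorem mem_span_X_pow_of_X_mul_mem {t : Set σ} {M : ℕ} {p : MvPolynomial σ R} {k : σ}
    (hk : k ∉ t)
    (h : p * X k ∈ Ideal.span ((fun i => (X i : MvPolynomial σ R) ^ M) '' t)) :
    p ∈ Ideal.span ((fun i => (X i : MvPolynomial σ R) ^ M) '' t) := by
  rw [mem_span_X_pow_image_iff] at h ⊢
  intro m hm
  obtain ⟨i, hi, hle⟩ := h (m + Finsupp.single k 1) (by
    rw [mem_support_iff, coeff_mul_X]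
    exact mem_support_iff.1 hm)
  have hik : k ≠ i := fun e => hk (e ▸ hi)
  exact ⟨i, hi, by simpa [Finsupp.single_apply, hik] using hle⟩

theorem coeff_eq_zero_of_mem_span_X_pow {M : ℕ} {p : MvPolynomial σ R} {m : σ →₀ ℕ}
    (hm : ∀ i, m i < M)
    (h : p ∈ Ideal.span (Set.range fun i => (X i : MvPolynomial σ R) ^ M)) :
    coeff m p = 0 := by
  rw [← Set.image_univ, mem_span_X_pow_image_iff] at h
  by_contra hc
  obtain ⟨i, -, hi⟩ := h m (mem_support_iff.2 hc)
  exact absurd hi (hm i).not_ge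

variable [Fintype σ] [DecidableEq σ]

theorem det_sub_det_mem_span_X_pow {M : ℕ} {A B : Matrix σ σ (MvPolynomial σ R)}
    (hA : A.mulVec X = fun i => X i ^ M) (hB : B.mulVec X = fun i => X i ^ M) :
    A.det - B.det ∈ Ideal.span (Set.range fun i => (X i : MvPolynomial σ R) ^ M) := by
  suffices H : ∀ s : Finset σ, (Matrix.of fun i => if i ∈ s then A i else B i).det - B.det ∈
      Ideal.span (Set.range fun i => (X i : MvPolynomial σ R) ^ M) by
    have := H Finset.univ
    simp only [Finset.mem_univ, if_true] at this
    exact this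
  intro s
  induction s using Finset.induction_on with
  | empty =>
    simp only [Finset.notMem_empty, if_false]
    change B.det - B.det ∈ _
    simp
  | insert k s hk ih =>
    set E : Matrix σ σ (MvPolynomial σ R) := Matrix.of fun i => if i ∈ s then A i else B i with hE
    have hrow : (Matrix.of fun i => if i ∈ insert k s then A i else B i) =
        E.updateRow k (B k + (A k - B k)) := by
      ext1 i
      by_cases hi : i = k
      · subst hi; simp
      · simp [hE, hi, Finset.mem_insert]
    have hself : E.updateRow k (B k) = E := by
      ext1 i
      by_cases hi : i = k
      · subst hi; simp [hE, hk]
      · simp [hi]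
    rw [hrow, Matrix.det_updateRow_add, hself, add_sub_right_comm]
    refine Ideal.add_mem _ ih ?_
    rw [← Set.image_univ]
    refine Ideal.span_mono (Set.image_mono (Set.subset_univ {k}ᶜ))
      (mem_span_X_pow_of_X_mul_mem (k := k) (by simp) (Matrix.det_mul_mem_of_mulVec_mem ?_ k))
    intro i
    have hAi := congrFun hA i
    have hBi := congrFun hB i
    change A i ⬝ᵥ X = X i ^ M at hAi
    change B i ⬝ᵥ X = X i ^ M at hBi
    change E.updateRow k (A k - B k) i ⬝ᵥ X ∈ _
    by_cases hi : i = k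
    · subst hi
      rw [Matrix.updateRow_self, sub_dotProduct, hAi, hBi, sub_self]
      exact Ideal.zero_mem _
    · have : E i ⬝ᵥ X = X i ^ M := by
        change (if i ∈ s then A i else B i) ⬝ᵥ X = X i ^ M
        split_ifs <;> assumption
      rw [Matrix.updateRow_ne hi, this]
      exact Ideal.subset_span ⟨i, hi, rfl⟩

end PowerIdeal

section Residue

variable {σ K : Type*} [Field K] [Fintype σ]

theorem exists_X_pow_mem_of_zeroLocus [IsAlgClosed K] {ι : Type*} {f : ι → MvPolynomial σ K}
    (hzero : ∀ p : σ → K, (∀ i, eval p (f i) = 0) → p = 0) (a : ℕ) :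
    ∃ k : ℕ, ∀ i, (X i : MvPolynomial σ K) ^ (k + a + 1) ∈ Ideal.span (Set.range f) := by
  have h : ∀ i, ∃ k : ℕ, (X i : MvPolynomial σ K) ^ k ∈ Ideal.span (Set.range f) := by
    intro i
    change X i ∈ (Ideal.span (Set.range f)).radical
    rw [← vanishingIdeal_zeroLocus_eq_radical (K := K), mem_vanishingIdeal_iff]
    intro p hp
    have : p = 0 := hzero p fun i => by
      simpa [aeval_eq_eval] using hp (f i) (Ideal.subset_span ⟨i, rfl⟩)
    simp [this]
  choose k hk using h
  refine ⟨∑ i, k i, fun i => ?_⟩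
  have : k i ≤ ∑ i, k i + a + 1 :=
    (Finset.single_le_sum (fun _ _ => Nat.zero_le _) (Finset.mem_univ i)).trans (by omega)
  exact Ideal.pow_mem_of_pow_mem _ (hk i) this

/-- A residue functional: it vanishes on the ideal of `f`, is concentrated in the socle degree,
and is `1` on the determinant of every matrix expressing `f` through the variables. -/
theorem exists_residue [DecidableEq σ] [IsAlgClosed K] {f : σ → MvPolynomial σ K} {b : ℕ}
    (hf : ∀ i, (f i).IsHomogeneous (b + 1))
    (hzero : ∀ p : σ → K, (∀ i, eval p (f i) = 0) → p = 0) :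
    ∃ L : MvPolynomial σ K →ₗ[K] K,
      (∀ p ∈ Ideal.span (Set.range f), L p = 0) ∧
      (∀ h k, h.IsHomogeneous k → k ≠ Fintype.card σ * b → L h = 0) ∧
      ∀ P : Matrix σ σ (MvPolynomial σ K), P.mulVec X = f → L P.det = 1 := by
  obtain ⟨k, hk⟩ := exists_X_pow_mem_of_zeroLocus hzero b
  set M := k + b + 1 with hM
  have hB : ∀ i, ∃ c : σ → MvPolynomial σ K, (∀ j, (c j).IsHomogeneous k) ∧
      ∑ j, c j * f j = X i ^ M := by
    intro i
    obtain ⟨c, hc⟩ := (Ideal.mem_span_range_iff_exists_fun).1 (hk i)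
    refine ⟨fun j => homogeneousComponent k (c j),
      fun j => homogeneousComponent_isHomogeneous _ _, ?_⟩
    have := congrArg (homogeneousComponent M) hc
    rw [map_sum, homogeneousComponent_eq_self (isHomogeneous_X_pow i M)] at this
    rw [← this]
    exact Finset.sum_congr rfl fun j _ =>
      (homogeneousComponent_add_mul_of_isHomogeneous (hf j) k (c j)).symm
  choose B hBhom hBf using hB
  have hBv : (Matrix.of B).mulVec f = fun i => X i ^ M := by
    ext1 i
    exact hBf i
  have hdetB : (Matrix.of B).det.IsHomogeneous (Fintype.card σ * k) := 
      isHomogeneous_det hBhom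
  set top : σ →₀ ℕ := Finsupp.equivFunOnFinite.symm fun _ => M - 1 with htop
  have htop_lt : ∀ i, top i < M := fun i => by simp [htop]; omega
  refine ⟨(lcoeff K top).comp (LinearMap.mulLeft K (Matrix.of B).det), ?_, ?_, ?_⟩
  · intro p hp
    refine coeff_eq_zero_of_mem_span_X_pow htop_lt ?_
    simp only [LinearMap.mulLeft_apply]
    induction hp using Submodule.span_induction with
    | mem x hx =>
      obtain ⟨i, rfl⟩ := hx
      exact Matrix.det_mul_mem_of_mulVec_mem
        (fun j => by rw [hBv]; exact Ideal.subset_span ⟨j, rfl⟩) i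
    | zero => simp
    | add x y _ _ hx hy => rw [mul_add]; exact Ideal.add_mem _ hx hy
    | smul r x _ hx => rw [smul_eq_mul, mul_left_comm]; exact Ideal.mul_mem_left _ _ hx
  · intro h e hh he
    refine (hdetB.mul hh).coeff_eq_zero fun hdeg => he ?_
    have : top.degree = Fintype.card σ * (k + b) := by
      simp [htop, Finsupp.degree_eq_sum, hM]
    rw [this, mul_add] at hdeg
    omega
  · intro P hP
    have h1 : (Matrix.of B * P).mulVec X = fun i => X i ^ M := by
      rw [← Matrix.mulVec_mulVec, hP, hBv]
    have h2 : (Matrix.diagonal fun i : σ => (X i : MvPolynomial σ K) ^ (M - 1)).mulVec X =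
        fun i => X i ^ M := by
      ext1 i
      rw [Matrix.mulVec_diagonal, ← pow_succ]
      rfl
    have h3 := coeff_eq_zero_of_mem_span_X_pow htop_lt (det_sub_det_mem_span_X_pow h1 h2)
    rw [Matrix.det_mul, Matrix.det_diagonal, coeff_sub, sub_eq_zero] at h3
    change coeff top ((Matrix.of B).det * P.det) = 1
    have h4 : (∏ i : σ, (X i : MvPolynomial σ K) ^ (M - 1)) = monomial top 1 := by
      rw [monomial_eq, Finsupp.prod_fintype _ _ (by simp)]
      simp [htop]
    rw [h3, h4, coeff_monomial, if_pos rfl]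

end Residue

section Bezout

variable {σ K : Type*} [Field K]

theorem C_sub_map_C_mem_span (h : MvPolynomial σ K) :
    (C h - map C h : MvPolynomial σ (MvPolynomial σ K)) ∈
      Ideal.span (Set.range fun j => C (X j) - X j) := by
  induction h using MvPolynomial.induction_on with
  | C a => simp
  | add p q hp hq =>
    rw [map_add, map_add, add_sub_add_comm]
    exact Ideal.add_mem _ hp hq
  | mul_X p j hp =>
    have : (C (p * X j) - map C (p * X j) : MvPolynomial σ (MvPolynomial σ K)) =
        C (X j) * (C p - map C p) + map C p * (C (X j) - X j) := by
      simp only [map_mul, map_X]; ring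
    rw [this]
    exact Ideal.add_mem _ (Ideal.mul_mem_left _ _ hp)
      (Ideal.mul_mem_left _ _ (Ideal.subset_span ⟨j, rfl⟩))

/-- The extension of a functional `L` on `K[x]` to a `K[x]`-linear map `K[x][y] → K[x]`,
acting by `L` on the variables `y`. -/
noncomputable def extendFunctional (L : MvPolynomial σ K →ₗ[K] K) :
    MvPolynomial σ (MvPolynomial σ K) →ₗ[MvPolynomial σ K] MvPolynomial σ K :=
  (basisMonomials σ (MvPolynomial σ K)).constr ℕ fun m => C (L (monomial m 1))

variable (L : MvPolynomial σ K →ₗ[K] K)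

theorem extendFunctional_monomial (m : σ →₀ ℕ) (p : MvPolynomial σ K) :
    extendFunctional L (monomial m p) = p * C (L (monomial m 1)) := by
  have h1 : extendFunctional L (monomial m 1) = C (L (monomial m 1)) := by
    have := (basisMonomials σ (MvPolynomial σ K)).constr_basis ℕ
      (fun m => (C (L (monomial m 1)) : MvPolynomial σ K)) m
    rwa [coe_basisMonomials] at this
  have h2 : (monomial m p : MvPolynomial σ (MvPolynomial σ K)) = p • monomial m 1 := by
    rw [smul_monomial, smul_eq_mul, mul_one]
  rw [h2, map_smul, h1, smul_eq_mul]

theorem extendFunctional_C_mul (p : MvPolynomial σ K) (q : MvPolynomial σ (MvPolynomial σ K)) :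
    extendFunctional L (C p * q) = p * extendFunctional L q := by
  rw [← smul_eq_C_mul, map_smul, smul_eq_mul]

theorem extendFunctional_map_C (g : MvPolynomial σ K) :
    extendFunctional L (map C g) = C (L g) := by
  induction g using MvPolynomial.induction_on' with
  | monomial m a =>
    have : (monomial m a : MvPolynomial σ K) = a • monomial m 1 := by
      rw [smul_monomial, smul_eq_mul, mul_one]
    rw [map_monomial, extendFunctional_monomial, this, map_smul, smul_eq_mul, C_mul]
  | add p q hp hq => simp only [map_add, hp, hq]

theorem extendFunctional_map_C_mul_monomial (g p : MvPolynomial σ K) (m : σ →₀ ℕ) :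
    extendFunctional L (map C g * monomial m p) = p * C (L (g * monomial m 1)) := by
  have : (map C g * monomial m p : MvPolynomial σ (MvPolynomial σ K)) =
      C p * map C (g * monomial m 1) := by
    rw [map_mul, map_monomial, map_one, mul_left_comm, C_mul_monomial, mul_one]
  rw [this, extendFunctional_C_mul, extendFunctional_map_C]

theorem extendFunctional_map_C_mul_eq_zero {g : MvPolynomial σ K}
    (hg : ∀ m, L (g * monomial m 1) = 0) (q : MvPolynomial σ (MvPolynomial σ K)) :
    extendFunctional L (map C g * q) = 0 := by
  induction q using MvPolynomial.induction_on' with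
  | monomial m p => rw [extendFunctional_map_C_mul_monomial, hg, map_zero, mul_zero]
  | add p q hp hq => rw [mul_add, map_add, hp, hq, add_zero]

theorem extendFunctional_map_C_mul_eq_constantCoeff {g : MvPolynomial σ K}
    (hg : ∀ m, m ≠ 0 → L (g * monomial m 1) = 0) (q : MvPolynomial σ (MvPolynomial σ K)) :
    extendFunctional L (map C g * q) = constantCoeff q * C (L g) := by
  classical
  induction q using MvPolynomial.induction_on' with
  | monomial m p =>
    rw [extendFunctional_map_C_mul_monomial, constantCoeff_monomial]
    split_ifs with h
    · subst h
      rw [← one_def, mul_one]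
    · rw [hg m h, map_zero, mul_zero, zero_mul]
  | add p q hp hq => rw [mul_add, map_add, hp, hq, map_add, add_mul]

theorem constantCoeff_extendFunctional (q : MvPolynomial σ (MvPolynomial σ K)) :
    constantCoeff (extendFunctional L q) = L (map constantCoeff q) := by
  induction q using MvPolynomial.induction_on' with
  | monomial m p =>
    have : (monomial m (constantCoeff p) : MvPolynomial σ K) = constantCoeff p • monomial m 1 := by
      rw [smul_monomial, smul_eq_mul, mul_one]
    rw [extendFunctional_monomial, map_monomial, this, map_smul, map_mul, constantCoeff_C,
      smul_eq_mul]
  | add p q hp hq => simp only [map_add, hp, hq]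

end Bezout

section Socle

variable {σ K : Type*} [Field K] [IsAlgClosed K] [Fintype σ] [DecidableEq σ]

/-- In the socle degree, a form is a scalar multiple of the determinant of any homogeneous matrix
expressing `f` through the variables, modulo the ideal of `f`. -/
theorem exists_sub_C_mul_det_mem {f : σ → MvPolynomial σ K} {b : ℕ}
    (hf : ∀ i, (f i).IsHomogeneous (b + 1)) (hb : b + 1 ≤ Fintype.card σ * b)
    (hzero : ∀ p : σ → K, (∀ i, eval p (f i) = 0) → p = 0)
    {P : Matrix σ σ (MvPolynomial σ K)} (hP : P.mulVec X = f)
    (hPhom : P.det.IsHomogeneous (Fintype.card σ * b))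
    {h : MvPolynomial σ K} (hh : h.IsHomogeneous (Fintype.card σ * b)) :
    ∃ c : K, h - C c * P.det ∈ Ideal.span (Set.range f) := by
  obtain ⟨L, hLI, hLdeg, hLdet⟩ := exists_residue hf hzero
  set I := Ideal.span (Set.range f) with hI
  set N := Fintype.card σ * b with hN
  have hIhom : ∀ p ∈ I, homogeneousComponent N p ∈ I := by
    intro p hp
    obtain ⟨c, rfl⟩ := (Ideal.mem_span_range_iff_exists_fun).1 hp
    rw [map_sum]
    refine I.sum_mem fun i _ => ?_
    obtain ⟨e, he⟩ := Nat.exists_eq_add_of_le' hb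
    rw [he, homogeneousComponent_add_mul_of_isHomogeneous (hf i)]
    exact I.mul_mem_left _ (Ideal.subset_span ⟨i, rfl⟩)
  choose A hA using fun i => (Ideal.mem_span_range_iff_exists_fun).1 (C_sub_map_C_mem_span (f i))
  set T : Matrix σ σ (MvPolynomial σ (MvPolynomial σ K)) := Matrix.of A with hT
  have hTv : T.mulVec (fun j => C (X j) - X j) = fun i => C (f i) - map C (f i) := by
    ext1 i
    exact hA i
  have hQ0 : (T.map (constantCoeff)).mulVec X = f := by
    ext1 i
    have := congrArg constantCoeff (hA i)
    have h0 : constantCoeff (map (C : K →+* MvPolynomial σ K) (f i)) = 0 := by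
      rw [constantCoeff_map, constantCoeff_eq, (hf i).coeff_eq_zero (by simp), map_zero]
    simpa [Matrix.mulVec, dotProduct, hT, h0] using this
  have hQ1 : (T.map (map constantCoeff)).mulVec X = f := by
    ext1 i
    have := congrArg (map constantCoeff) (hA i)
    have h0 : constantCoeff (f i) = 0 := by
      rw [constantCoeff_eq, (hf i).coeff_eq_zero (by simp)]
    have h1 : map constantCoeff (map (C : K →+* MvPolynomial σ K) (f i)) = f i := by
      rw [map_map, constantCoeff_comp_C, map_id]
    simpa [Matrix.mulVec, dotProduct, hT, h0, h1] using this
  have hu : constantCoeff (extendFunctional L T.det) = 1 := by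
    rw [constantCoeff_extendFunctional, RingHom.map_det]
    exact hLdet _ hQ1
  have key : ∀ g : MvPolynomial σ K, g.IsHomogeneous N →
      g - C (L g) * homogeneousComponent N (T.map constantCoeff).det ∈ I := by
    intro g hg
    have h1 : (C g - map C g) * T.det ∈
        Ideal.span (Set.range fun i => (C (f i) - map C (f i) :
          MvPolynomial σ (MvPolynomial σ K))) := by
      obtain ⟨c, hc⟩ := (Ideal.mem_span_range_iff_exists_fun).1 (C_sub_map_C_mem_span g)
      rw [← hc, Finset.sum_mul]
      refine Ideal.sum_mem _ fun j _ => ?_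
      rw [mul_assoc, mul_comm (C (X j) - X j)]
      refine Ideal.mul_mem_left _ _ (Matrix.det_mul_mem_of_mulVec_mem
        (v := fun j => C (X j) - X j) (fun i => ?_) j)
      rw [hTv]
      exact Ideal.subset_span ⟨i, rfl⟩
    obtain ⟨c, hc⟩ := (Ideal.mem_span_range_iff_exists_fun).1 h1
    have h2 : extendFunctional L ((C g - map C g) * T.det) ∈ I := by
      rw [← hc, map_sum]
      refine I.sum_mem fun i _ => ?_
      rw [mul_comm, sub_mul, map_sub, extendFunctional_C_mul,
        extendFunctional_map_C_mul_eq_zero L (fun m => hLI _ (I.mul_mem_right _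
          (Ideal.subset_span ⟨i, rfl⟩))), sub_zero]
      exact I.mul_mem_right _ (Ideal.subset_span ⟨i, rfl⟩)
    rw [sub_mul, map_sub, extendFunctional_C_mul, extendFunctional_map_C_mul_eq_constantCoeff L
      (fun m hm => hLdeg _ _ (hg.mul (isHomogeneous_monomial 1 rfl)) (by
        have : m.degree ≠ 0 := fun e => hm ((Finsupp.degree_eq_zero_iff m).1 e)
        omega)), RingHom.map_det] at h2
    have h3 := hIhom _ h2
    have h4 : homogeneousComponent N (g * extendFunctional L T.det) = g := by
      have := homogeneousComponent_add_mul_of_isHomogeneous hg 0 (extendFunctional L T.det)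
      rw [zero_add, homogeneousComponent_zero, ← constantCoeff_eq, hu, C_1, one_mul] at this
      rw [mul_comm, this]
    rw [map_sub, h4, mul_comm _ (C (L g)), homogeneousComponent_C_mul] at h3
    exact h3
  refine ⟨L h, ?_⟩
  have hPk := key P.det hPhom
  rw [hLdet P hP, C_1, one_mul] at hPk
  have := I.sub_mem (key h hh) (I.mul_mem_left (C (L h)) hPk)
  convert this using 1
  ring

end Socle

section Apolarity

variable {n : ℕ}

/-- The product `m_1! ⋯ m_n!`, as a complex number. -/
noncomputable def factorialWeight (m : Fin n →₀ ℕ) : ℂ :=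
  ∏ i, ((m i).factorial : ℂ)

theorem factorialWeight_ne_zero (m : Fin n →₀ ℕ) : factorialWeight m ≠ 0 :=
  Finset.prod_ne_zero_iff.2 fun _ _ => Nat.cast_ne_zero.2 (Nat.factorial_ne_zero _)

theorem factorialWeight_add_single (m : Fin n →₀ ℕ) (i : Fin n) :
    factorialWeight (m + Finsupp.single i 1) = (m i + 1) * factorialWeight m := by
  unfold factorialWeight
  rw [Fintype.prod_eq_mul_prod_compl i, Fintype.prod_eq_mul_prod_compl i, ← mul_assoc]
  congr 1
  · simp [Nat.factorial_succ]
  · refine Finset.prod_congr rfl fun j hj => ?_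
    have : i ≠ j := fun e => by simp [e] at hj
    simp [this]

theorem factorialWeight_mul_coeff_pdEnd_pow (i : Fin n) (k : ℕ) (α : Fin n →₀ ℕ)
    (G : MvPolynomial (Fin n) ℂ) :
    factorialWeight α * coeff α ((pdEnd n i ^ k) G) =
      factorialWeight (α + Finsupp.single i k) * coeff (α + Finsupp.single i k) G := by
  induction k generalizing α with
  | zero => simp
  | succ k ih =>
    rw [pow_succ', Module.End.mul_apply]
    change factorialWeight α * coeff α (pderiv i ((pdEnd n i ^ k) G)) = _
    have := ih (α + Finsupp.single i 1)
    rw [add_assoc, ← Finsupp.single_add, add_comm 1 k] at this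
    rw [coeff_pderiv, ← this, factorialWeight_add_single]
    ring

theorem factorialWeight_mul_coeff_prod_pdEnd (l : List (Fin n)) (m α : Fin n →₀ ℕ)
    (G : MvPolynomial (Fin n) ℂ) :
    factorialWeight α * coeff α ((l.map fun i => pdEnd n i ^ m i).prod G) =
      factorialWeight (α + (l.map fun i => Finsupp.single i (m i)).sum) *
        coeff (α + (l.map fun i => Finsupp.single i (m i)).sum) G := by
  induction l generalizing α with
  | nil => simp
  | cons i l ih =>
    rw [List.map_cons, List.prod_cons, Module.End.mul_apply, factorialWeight_mul_coeff_pdEnd_pow,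
      ih, List.map_cons, List.sum_cons, add_assoc]

theorem factorialWeight_mul_coeff_monomial_diamond (m α : Fin n →₀ ℕ)
    (G : MvPolynomial (Fin n) ℂ) :
    factorialWeight α * coeff α ((List.ofFn fun i => pdEnd n i ^ m i).prod G) =
      factorialWeight (α + m) * coeff (α + m) G := by
  have h : ((List.finRange n).map fun i => Finsupp.single i (m i)).sum = m := by
    rw [← List.ofFn_eq_map, List.sum_ofFn, Finsupp.univ_sum_single]
  rw [List.ofFn_eq_map, factorialWeight_mul_coeff_prod_pdEnd, h]

/-- The functional `g ↦ (g ⋄ F)(0)`. -/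
noncomputable def apolarFunctional (F : MvPolynomial (Fin n) ℂ) :
    MvPolynomial (Fin n) ℂ →ₗ[ℂ] ℂ :=
  (basisMonomials (Fin n) ℂ).constr ℂ fun m => factorialWeight m * coeff m F

theorem apolarFunctional_monomial (F : MvPolynomial (Fin n) ℂ) (m : Fin n →₀ ℕ) (a : ℂ) :
    apolarFunctional F (monomial m a) = a * (factorialWeight m * coeff m F) := by
  have h1 : apolarFunctional F (monomial m 1) = factorialWeight m * coeff m F := by
    have := (basisMonomials (Fin n) ℂ).constr_basis ℂ
      (fun m => factorialWeight m * coeff m F) m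
    rwa [coe_basisMonomials] at this
  have h2 : (monomial m a : MvPolynomial (Fin n) ℂ) = a • monomial m 1 := by
    rw [smul_monomial, smul_eq_mul, mul_one]
  rw [h2, map_smul, h1, smul_eq_mul]

theorem apolarFunctional_mul_monomial (F g : MvPolynomial (Fin n) ℂ) (α : Fin n →₀ ℕ) (a : ℂ) :
    apolarFunctional F (g * monomial α a) =
      a * (factorialWeight α * coeff α (diamond g F)) := by
  conv_lhs => rw [g.as_sum]
  rw [diamond, coeff_sum, Finset.sum_mul, map_sum, Finset.mul_sum, Finset.mul_sum]
  refine Finset.sum_congr rfl fun m _ => ?_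
  rw [monomial_mul, apolarFunctional_monomial, add_comm m α,
    ← factorialWeight_mul_coeff_monomial_diamond, coeff_smul, smul_eq_mul]
  ring

theorem apolarFunctional_eq_zero_of_mem_span {ι : Type*} [Fintype ι] {F : MvPolynomial (Fin n) ℂ}
    {f : ι → MvPolynomial (Fin n) ℂ} (hf : ∀ i, diamond (f i) F = 0)
    {p : MvPolynomial (Fin n) ℂ} (hp : p ∈ Ideal.span (Set.range f)) :
    apolarFunctional F p = 0 := by
  obtain ⟨c, rfl⟩ := Ideal.mem_span_range_iff_exists_fun.1 hp
  rw [map_sum]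
  refine Finset.sum_eq_zero fun i _ => ?_
  rw [mul_comm]
  induction c i using MvPolynomial.induction_on' with
  | monomial m a => rw [apolarFunctional_mul_monomial, hf i, coeff_zero, mul_zero, mul_zero]
  | add p q hp hq => rw [mul_add, map_add, hp, hq, add_zero]

theorem prod_X_pow_eq_monomial_equivFunOnFinite (m : Fin n → ℕ) :
    (∏ i, X i ^ m i : MvPolynomial (Fin n) ℂ) =
      monomial (Finsupp.equivFunOnFinite.symm m) 1 := by
  rw [monomial_eq, Finsupp.prod_fintype _ _ (by simp)]
  simp

theorem coeff_assocForm {d : ℕ} (μ : (Fin n → ℕ) → ℂ) {s : Fin n →₀ ℕ}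
    (hs : s.degree = n * (d - 2)) :
    coeff s (assocForm n d μ) = (Nat.multinomial Finset.univ s : ℂ) * μ s := by
  have hmem : (s : Fin n → ℕ) ∈ Finset.Nat.antidiagonalTuple n (n * (d - 2)) := by
    rw [Finset.Nat.mem_antidiagonalTuple, ← hs, Finsupp.degree_eq_sum]
  rw [assocForm, coeff_sum, Finset.sum_eq_single_of_mem _ hmem]
  · rw [prod_X_pow_eq_monomial_equivFunOnFinite, coeff_C_mul, coeff_monomial]
    simp
  · intro m _ hm
    rw [prod_X_pow_eq_monomial_equivFunOnFinite, coeff_C_mul, coeff_monomial, if_neg, mul_zero]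
    rintro rfl
    exact hm rfl

theorem isHomogeneous_assocForm (d : ℕ) (μ : (Fin n → ℕ) → ℂ) :
    (assocForm n d μ).IsHomogeneous (n * (d - 2)) := by
  refine IsHomogeneous.sum _ _ _ fun m hm => IsHomogeneous.C_mul ?_ _
  have := IsHomogeneous.prod Finset.univ (fun i => (X i : MvPolynomial (Fin n) ℂ) ^ m i) m
    fun i _ => isHomogeneous_X_pow i _
  rwa [Finset.Nat.mem_antidiagonalTuple.1 hm] at this

theorem eq_smul_assocForm_of_diamond_eq_zero {d : ℕ} {F : MvPolynomial (Fin n) ℂ}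
    (hF : F.IsHomogeneous (n * (d - 2))) {f : Fin n → MvPolynomial (Fin n) ℂ}
    (hf : ∀ i, diamond (f i) F = 0) {μ : (Fin n → ℕ) → ℂ} (hμ : IsAssocCoeffsT n d f μ) :
    F = (apolarFunctional F (jacPoly n f) / (n * (d - 2)).factorial) • assocForm n d μ := by
  ext s
  rw [coeff_smul, smul_eq_mul]
  by_cases hs : s.degree = n * (d - 2)
  · have hsum : ∑ i, s i = n * (d - 2) := by rw [← hs, Finsupp.degree_eq_sum]
    have h := apolarFunctional_eq_zero_of_mem_span hf (hμ s hsum)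
    rw [map_sub, C_mul', map_smul, prod_X_pow_eq_monomial_equivFunOnFinite,
      apolarFunctional_monomial, one_mul, smul_eq_mul, sub_eq_zero,
      Finsupp.equivFunOnFinite_symm_coe] at h
    have hfact : factorialWeight s * (Nat.multinomial Finset.univ s : ℂ) =
        ((n * (d - 2)).factorial : ℂ) := by
      have := Nat.multinomial_spec Finset.univ (s : Fin n → ℕ)
      rw [hsum] at this
      rw [← this, factorialWeight]
      push_cast
      rfl
    have hN : ((n * (d - 2)).factorial : ℂ) ≠ 0 := Nat.cast_ne_zero.2 (Nat.factorial_ne_zero _)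
    refine mul_left_cancel₀ (factorialWeight_ne_zero s) ?_
    rw [h, coeff_assocForm μ hs, mul_left_comm, ← mul_assoc (factorialWeight s), hfact]
    field_simp
  · rw [hF.coeff_eq_zero hs, (isHomogeneous_assocForm d μ).coeff_eq_zero hs, mul_zero]

end Apolarity

section AssociatedForm

variable {n d : ℕ}

theorem exists_isAssocCoeffsT (hn : 2 ≤ n) (hd : 3 ≤ d) {f : Fin n → MvPolynomial (Fin n) ℂ}
    (hf : ∀ i, (f i).IsHomogeneous (d - 1))
    (hzero : ∀ p : Fin n → ℂ, (∀ i, eval p (f i) = 0) → p = 0) :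
    ∃ μ : (Fin n → ℕ) → ℂ, IsAssocCoeffsT n d f μ := by
  obtain ⟨b, rfl⟩ := Nat.exists_eq_add_of_le' (show 2 ≤ d by omega)
  have hbn : b + 1 ≤ Fintype.card (Fin n) * b := by
    rw [Fintype.card_fin]
    nlinarith
  have hb0 : (((b + 1 : ℕ) : ℂ)) ≠ 0 := Nat.cast_ne_zero.2 (by omega)
  set v : Fin n → MvPolynomial (Fin n) ℂ := fun _ => C (((b + 1 : ℕ) : ℂ)⁻¹) with hv
  set P : Matrix (Fin n) (Fin n) (MvPolynomial (Fin n) ℂ) :=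
    Matrix.of fun i j => v i * pderiv j (f i) with hP
  have hPX : P.mulVec X = f := by
    ext1 i
    have h := (hf i).sum_X_mul_pderiv
    change ∑ j, v i * pderiv j (f i) * X j = f i
    simp only [mul_assoc, mul_comm (pderiv _ (f i))]
    rw [← Finset.mul_sum, h, hv, nsmul_eq_mul, ← mul_assoc, ← map_natCast (C (σ := Fin n)),
      ← C_mul]
    change C (((b + 1 : ℕ) : ℂ)⁻¹ * ((b + 1 : ℕ) : ℂ)) * f i = f i
    rw [inv_mul_cancel₀ hb0, C_1, one_mul]
  have hdet : P.det = C ((((b + 1 : ℕ) : ℂ)⁻¹) ^ n) * jacPoly n f := by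
    have := Matrix.det_mul_column v (Matrix.of fun i j => pderiv j (f i))
    rw [Finset.prod_const, Finset.card_fin, ← C_pow] at this
    exact this
  have hPhom : P.det.IsHomogeneous (Fintype.card (Fin n) * b) :=
    isHomogeneous_det fun i j => ((hf i).pderiv (i := j)).C_mul _
  have h : ∀ m : Fin n → ℕ, ∃ c : ℂ, ∑ i, m i = n * b →
      (∏ i, X i ^ m i) - C c * jacPoly n f ∈ Ideal.span (Set.range f) := by
    intro m
    by_cases hm : ∑ i, m i = n * b
    · have hmon := IsHomogeneous.prod Finset.univ
        (fun i => (X i : MvPolynomial (Fin n) ℂ) ^ m i) m fun i _ => isHomogeneous_X_pow i _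
      rw [hm] at hmon
      obtain ⟨c, hc⟩ := exists_sub_C_mul_det_mem (b := b) hf hbn hzero hPX hPhom
        (by rwa [Fintype.card_fin])
      rw [hdet, ← mul_assoc, ← C_mul] at hc
      exact ⟨_, fun _ => hc⟩
    · exact ⟨0, fun h => absurd h hm⟩
  choose μ hμ using h
  exact ⟨μ, hμ⟩

/-- Rescaling one form of the tuple by `c⁻¹` rescales the coefficients of the associated form
by `c`. -/
theorem IsAssocCoeffsT.exists_rescale (i₀ : Fin n) {f : Fin n → MvPolynomial (Fin n) ℂ}
    {μ : (Fin n → ℕ) → ℂ} (hμ : IsAssocCoeffsT n d f μ) {c : ℂ} (hc : c ≠ 0) :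
    ∃ v : Fin n → ℂ, (∀ i, v i ≠ 0) ∧
      IsAssocCoeffsT n d (fun i => C (v i) * f i) fun m => c * μ m := by
  set v : Fin n → ℂ := fun i => if i = i₀ then c⁻¹ else 1 with hv
  have hv0 : ∀ i, v i ≠ 0 := fun i => by
    simp only [hv]
    split_ifs
    · exact inv_ne_zero hc
    · exact one_ne_zero
  refine ⟨v, hv0, ?_⟩
  have hprod : ∏ i, v i = c⁻¹ := by simp [hv]
  have hjac : jacPoly n (fun i => C (v i) * f i) = C c⁻¹ * jacPoly n f := by
    have := Matrix.det_mul_column (fun i => (C (v i) : MvPolynomial (Fin n) ℂ))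
      (Matrix.of fun i j => pderiv j (f i))
    rw [← map_prod, hprod] at this
    simp only [jacPoly, pderiv_C_mul]
    exact this
  have hle : Ideal.span (Set.range f) ≤ Ideal.span (Set.range fun i => C (v i) * f i) := by
    rw [Ideal.span_le]
    rintro _ ⟨i, rfl⟩
    have : f i = C (v i)⁻¹ * (C (v i) * f i) := by
      rw [← mul_assoc, ← C_mul, inv_mul_cancel₀ (hv0 i), C_1, one_mul]
    rw [this]
    exact Ideal.mul_mem_left _ _ (Ideal.subset_span ⟨i, rfl⟩)
  intro m hm
  dsimp only
  rw [hjac, ← mul_assoc, ← C_mul, mul_comm c, mul_inv_cancel_right₀ hc]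
  exact hle (hμ m hm)

theorem assocForm_const_mul (c : ℂ) (μ : (Fin n → ℕ) → ℂ) :
    assocForm n d (fun m => c * μ m) = c • assocForm n d μ := by
  simp only [assocForm, Finset.smul_sum, smul_eq_C_mul, ← mul_assoc, ← C_mul]
  refine Finset.sum_congr rfl fun m _ => ?_
  rw [mul_comm c]

end AssociatedForm

end MvPolynomial

/-- If `F` is a nonzero form of degree `n(d-2)` such that
`F^⊥ ∩ ℂ[z]_{d-1}` is `n`-dimensional with a basis `f = (f_1,…,f_n)` whose only common zero
is the origin, then `F` is a nonzero scalar multiple of the associated form of `f`;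
in particular `F` is the associated form of some such `n`-tuple. -/
theorem eq_smul_assocForm_of_apolar_basis
    (n d : ℕ) (hn : 2 ≤ n) (hd : 3 ≤ d)
    (F : MvPolynomial (Fin n) ℂ)
    (hF : F.IsHomogeneous (n * (d - 2))) (hF0 : F ≠ 0)
    (f : Fin n → MvPolynomial (Fin n) ℂ)
    (hfhom : ∀ i, (f i).IsHomogeneous (d - 1))
    (hfperp : ∀ i, diamond (f i) F = 0)
    (hfli : LinearIndependent ℂ f)
    (hfspan : ∀ g : MvPolynomial (Fin n) ℂ,
      g.IsHomogeneous (d - 1) → diamond g F = 0 → g ∈ Submodule.span ℂ (Set.range f))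
    (hzero : ∀ p : Fin n → ℂ, (∀ i, eval p (f i) = 0) → p = 0) :
    (∀ μ : (Fin n → ℕ) → ℂ, IsAssocCoeffsT n d f μ →
        ∃ c : ℂ, c ≠ 0 ∧ F = c • assocForm n d μ)
      ∧ (∃ g : Fin n → MvPolynomial (Fin n) ℂ,
          (∀ i, (g i).IsHomogeneous (d - 1))
            ∧ (∀ p : Fin n → ℂ, (∀ i, eval p (g i) = 0) → p = 0)
            ∧ ∃ μ : (Fin n → ℕ) → ℂ, IsAssocCoeffsT n d g μ ∧ F = assocForm n d μ) := by
  have hscalar : ∀ μ : (Fin n → ℕ) → ℂ, IsAssocCoeffsT n d f μ →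
      ∃ c : ℂ, c ≠ 0 ∧ F = c • assocForm n d μ := by
    intro μ hμ
    have h := eq_smul_assocForm_of_diamond_eq_zero hF hfperp hμ
    refine ⟨_, fun h0 => hF0 ?_, h⟩
    rw [h, h0, zero_smul]
  refine ⟨hscalar, ?_⟩
  obtain ⟨μ, hμ⟩ := exists_isAssocCoeffsT hn hd hfhom hzero
  obtain ⟨c, hc, hFc⟩ := hscalar μ hμ
  obtain ⟨v, hv, hvμ⟩ := IsAssocCoeffsT.exists_rescale ⟨0, by omega⟩ hμ hc
  refine ⟨fun i => C (v i) * f i, fun i => (hfhom i).C_mul _, fun p hp => hzero p fun i => ?_,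
    _, hvμ, by rw [hFc, assocForm_const_mul]⟩
  have := hp i
  rw [eval_mul, eval_C] at this
  exact (mul_eq_zero.1 this).resolve_left (hv i)
end

section
/- Let d ≥ 3, set N := d−2, and let F = Σ_{i=0}^{2N} binom(2N,i)·a_i·e_1^{2N−i}e_2^i be a binary form of degree 2N = 2(d−2). Define the catalecticant Cat(F) := det of the (N+1)×(N+1) matrix whose (i,j)-entry (0 ≤ i,j ≤ N) is a_{i+j}. Then Cat(F) ≠ 0 if and only if the subspace F^⊥ ∩ ℂ[z_1,z_2]_{d−1} is 2-dimensional and admits a basis (f_1,f_2) whose only common zero in ℂ² is the origin. -/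
open MvPolynomial

section BinaryForms

open Finsupp in
/-- The exponent vector of the monomial `x_0^(n-k) x_1^k`. -/
noncomputable def binExp (n k : ℕ) : Fin 2 →₀ ℕ := single 0 (n - k) + single 1 k

@[simp] lemma binExp_zero (n k : ℕ) : binExp n k 0 = n - k := by simp [binExp]

@[simp] lemma binExp_one (n k : ℕ) : binExp n k 1 = k := by simp [binExp]

lemma binExp_inj {n k l : ℕ} : binExp n k = binExp n l ↔ k = l :=
  ⟨fun h => by simpa using DFunLike.congr_fun h 1, fun h => h ▸ rfl⟩

lemma monomial_binExp (n k : ℕ) (c : ℂ) :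
    monomial (binExp n k) c = C c * X 0 ^ (n - k) * X 1 ^ k := by
  rw [binExp, monomial_eq, mul_assoc]
  simp [Finsupp.prod_fintype, Fin.prod_univ_two]

lemma eq_binExp_of_degree_eq {m : Fin 2 →₀ ℕ} {n : ℕ} (h : m.degree = n) :
    m = binExp n (m 1) := by
  rw [Finsupp.degree_eq_sum, Fin.sum_univ_two] at h
  ext i
  fin_cases i
  · simp [← h]
  · simp

/-- The binary form of degree `n` with coefficient vector `c`. -/
noncomputable def binForm (n : ℕ) : (Fin (n + 1) → ℂ) →ₗ[ℂ] MvPolynomial (Fin 2) ℂ :=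
  ∑ k : Fin (n + 1), monomial (binExp n k) ∘ₗ LinearMap.proj k

lemma binForm_apply (n : ℕ) (c : Fin (n + 1) → ℂ) :
    binForm n c = ∑ k : Fin (n + 1), monomial (binExp n k) (c k) := by
  simp [binForm]

lemma coeff_binForm (n : ℕ) (c : Fin (n + 1) → ℂ) (k : Fin (n + 1)) :
    coeff (binExp n k) (binForm n c) = c k := by
  classical
  simp [binForm_apply, coeff_sum, coeff_monomial, binExp_inj, Fin.val_inj]

lemma binForm_injective (n : ℕ) : Function.Injective (binForm n) := fun c c' h => by
  ext k
  rw [← coeff_binForm n c, h, coeff_binForm]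

lemma isHomogeneous_binForm (n : ℕ) (c : Fin (n + 1) → ℂ) : (binForm n c).IsHomogeneous n := by
  rw [binForm_apply]
  refine IsHomogeneous.sum _ _ _ fun k _ => isHomogeneous_monomial _ ?_
  rw [Finsupp.degree_eq_sum, Fin.sum_univ_two, binExp_zero, binExp_one]
  have := k.is_lt
  omega

lemma exists_binForm_eq {n : ℕ} {g : MvPolynomial (Fin 2) ℂ} (hg : g.IsHomogeneous n) :
    ∃ c, binForm n c = g := by
  refine ⟨fun k => coeff (binExp n k) g, ?_⟩
  ext m
  by_cases hm : m.degree = n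
  · have hlt : m 1 < n + 1 := by
      rw [Finsupp.degree_eq_sum, Fin.sum_univ_two] at hm
      omega
    rw [eq_binExp_of_degree_eq hm]
    exact coeff_binForm n _ ⟨m 1, hlt⟩
  · rw [(isHomogeneous_binForm n _).coeff_eq_zero hm, hg.coeff_eq_zero hm]

lemma eval_binForm (n : ℕ) (c : Fin (n + 1) → ℂ) (p : Fin 2 → ℂ) :
    eval p (binForm n c) = ∑ k : Fin (n + 1), c k * (p 0 ^ (n - k : ℕ) * p 1 ^ (k : ℕ)) := by
  simp [binForm_apply, monomial_binExp, mul_assoc]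

lemma X_zero_mul_binForm (n : ℕ) (c : Fin (n + 1) → ℂ) :
    X 0 * binForm n c = binForm (n + 1) (Fin.snoc c 0 : Fin (n + 2) → ℂ) := by
  rw [binForm_apply, binForm_apply, Finset.mul_sum, Fin.sum_univ_castSucc (n := n + 1)]
  simp only [Fin.snoc_castSucc, Fin.snoc_last, monomial_zero, add_zero, monomial_binExp,
    Fin.val_castSucc]
  refine Finset.sum_congr rfl fun k _ => ?_
  rw [Nat.succ_sub (Nat.lt_succ_iff.mp k.is_lt), pow_succ]
  ring

lemma X_one_mul_binForm (n : ℕ) (c : Fin (n + 1) → ℂ) :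
    X 1 * binForm n c = binForm (n + 1) (Fin.cons 0 c : Fin (n + 2) → ℂ) := by
  rw [binForm_apply, binForm_apply, Finset.mul_sum, Fin.sum_univ_succ (n := n + 1)]
  simp only [Fin.cons_succ, Fin.cons_zero, monomial_zero, zero_add, monomial_binExp,
    Fin.val_succ]
  refine Finset.sum_congr rfl fun k _ => ?_
  rw [Nat.add_sub_add_right]
  ring

/-- A nonzero-degree binary form over `ℂ` has a nontrivial zero. -/
lemma exists_ne_zero_eval_binForm_eq_zero {n : ℕ} (hn : n ≠ 0) (c : Fin (n + 1) → ℂ) :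
    ∃ p : Fin 2 → ℂ, p ≠ 0 ∧ eval p (binForm n c) = 0 := by
  by_cases hc : c (Fin.last n) = 0
  · refine ⟨![0, 1], fun h => one_ne_zero (congrFun h 1), ?_⟩
    rw [eval_binForm, Fin.sum_univ_castSucc, hc]
    simp only [zero_mul, add_zero]
    refine Finset.sum_eq_zero fun k _ => ?_
    have : n - (k : ℕ) ≠ 0 := by have := k.is_lt; omega
    simp [this]
  · let q : Polynomial ℂ := ∑ k : Fin (n + 1), Polynomial.monomial k (c k)
    have hq : q.coeff n = c (Fin.last n) := by
      simp only [q, Polynomial.finsetSum_coeff, Polynomial.coeff_monomial]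
      rw [Finset.sum_eq_single (Fin.last n)]
      · simp
      · intro k _ hk
        exact if_neg fun h => hk (Fin.ext h)
      · simp
    have hdeg : q.degree ≠ 0 := by
      intro h
      have : (n : WithBot ℕ) ≤ q.degree := Polynomial.le_degree_of_ne_zero (hq ▸ hc)
      rw [h] at this
      exact hn (by simpa using this)
    obtain ⟨t, ht⟩ := IsAlgClosed.exists_root q hdeg
    refine ⟨![1, t], fun h => one_ne_zero (congrFun h 0), ?_⟩
    simpa [eval_binForm, q, Polynomial.IsRoot, Polynomial.eval_finsetSum] using ht

end BinaryForms

section Apolarity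

/-- The binary form `∑ binom(n,i) a_i e_0^(n-i) e_1^i`. -/
noncomputable def dividedForm (n : ℕ) (a : ℕ → ℂ) : MvPolynomial (Fin 2) ℂ :=
  ∑ i ∈ Finset.range (n + 1), C ((n.choose i : ℂ) * a i) * X 0 ^ (n - i) * X 1 ^ i

lemma dividedForm_eq_binForm (n : ℕ) (a : ℕ → ℂ) :
    dividedForm n a = binForm n fun i => (n.choose i : ℂ) * a i := by
  simp only [binForm_apply, dividedForm, Finset.sum_range, monomial_binExp]

lemma dividedForm_eq_zero_iff (n : ℕ) (a : ℕ → ℂ) :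
    dividedForm n a = 0 ↔ ∀ j ≤ n, a j = 0 := by
  rw [dividedForm_eq_binForm, map_eq_zero_iff _ (binForm_injective n), funext_iff]
  constructor
  · intro h j hj
    have := h ⟨j, Nat.lt_succ_of_le hj⟩
    simpa [(Nat.choose_pos hj).ne'] using this
  · intro h j
    simp [h j (Nat.lt_succ_iff.mp j.is_lt)]

lemma sum_smul_dividedForm {ι : Type*} (s : Finset ι) (n : ℕ) (c : ι → ℂ) (a : ι → ℕ → ℂ) :
    ∑ k ∈ s, c k • dividedForm n (a k) = dividedForm n fun j => ∑ k ∈ s, c k * a k j := by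
  simp only [dividedForm_eq_binForm, ← map_smul, ← map_sum]
  congr 1
  ext j
  simp only [Finset.sum_apply, Pi.smul_apply, smul_eq_mul, Finset.mul_sum]
  exact Finset.sum_congr rfl fun k _ => by ring

lemma pdEnd_zero_dividedForm (n : ℕ) (a : ℕ → ℂ) :
    pdEnd 2 0 (dividedForm (n + 1) a) = ((n + 1 : ℕ) : ℂ) • dividedForm n a := by
  change pderiv 0 _ = _
  rw [dividedForm, Finset.sum_range_succ, dividedForm, map_add, map_sum, Finset.smul_sum]
  simp only [Derivation.leibniz, Derivation.leibniz_pow, pderiv_C, pderiv_X_self,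
    pderiv_X_of_ne (show (1 : Fin 2) ≠ 0 by decide), Nat.sub_self]
  simp only [smul_zero, smul_eq_mul, mul_zero, zero_smul, zero_add, add_zero, mul_one]
  refine Finset.sum_congr rfl fun i hi => ?_
  have hi : i ≤ n := Nat.lt_succ_iff.mp (Finset.mem_range.mp hi)
  have hch : ((n.choose i : ℂ)) * (n + 1 : ℕ) = ((n + 1).choose i) * (n + 1 - i : ℕ) :=
    mod_cast Nat.choose_mul_succ_eq n i
  have hC := congrArg (C (σ := Fin 2)) hch
  rw [show n + 1 - i - 1 = n - i by omega]
  simp only [nsmul_eq_mul, smul_eq_C_mul, map_mul, map_natCast] at hC ⊢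
  linear_combination (-(C (a i)) * X 0 ^ (n - i) * X 1 ^ i) * hC

lemma pdEnd_one_dividedForm (n : ℕ) (a : ℕ → ℂ) :
    pdEnd 2 1 (dividedForm (n + 1) a) =
      ((n + 1 : ℕ) : ℂ) • dividedForm n (fun i => a (i + 1)) := by
  change pderiv 1 _ = _
  rw [dividedForm, Finset.sum_range_succ', dividedForm, map_add, map_sum, Finset.smul_sum]
  simp only [Derivation.leibniz, Derivation.leibniz_pow, pderiv_C, pderiv_X_self,
    pderiv_X_of_ne (show (0 : Fin 2) ≠ 1 by decide), Nat.add_sub_add_right]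
  simp only [smul_zero, smul_eq_mul, mul_zero, zero_smul, add_zero, mul_one]
  refine Finset.sum_congr rfl fun i _ => ?_
  have hch : ((n + 1 : ℕ) : ℂ) * n.choose i = ((n + 1).choose (i + 1)) * (i + 1 : ℕ) :=
    mod_cast Nat.add_one_mul_choose_eq n i
  have hC := congrArg (C (σ := Fin 2)) hch
  simp only [nsmul_eq_mul, smul_eq_C_mul, map_mul, map_natCast, Nat.add_sub_cancel] at hC ⊢
  linear_combination (-(C (a (i + 1))) * X 0 ^ (n - i) * X 1 ^ i) * hC

lemma pdEnd_zero_pow_dividedForm (n p : ℕ) (a : ℕ → ℂ) :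
    (pdEnd 2 0 ^ p) (dividedForm (n + p) a) =
      ((n + p).descFactorial p : ℂ) • dividedForm n a := by
  induction p with
  | zero => simp
  | succ p ih =>
    rw [pow_succ, Module.End.mul_apply, ← add_assoc, pdEnd_zero_dividedForm, map_smul, ih,
      smul_smul, Nat.succ_descFactorial_succ, Nat.cast_mul]

lemma pdEnd_one_pow_dividedForm (n q : ℕ) (a : ℕ → ℂ) :
    (pdEnd 2 1 ^ q) (dividedForm (n + q) a) =
      ((n + q).descFactorial q : ℂ) • dividedForm n (fun i => a (i + q)) := by
  induction q generalizing a with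
  | zero => simp
  | succ q ih =>
    rw [pow_succ, Module.End.mul_apply, ← add_assoc, pdEnd_one_dividedForm, map_smul, ih,
      smul_smul, Nat.succ_descFactorial_succ, Nat.cast_mul]
    simp only [add_assoc]

lemma diamond_eq_linearCombination {n : ℕ} (g F : MvPolynomial (Fin n) ℂ) :
    diamond g F = Finsupp.linearCombination ℂ
      (fun m : Fin n →₀ ℕ => (List.ofFn fun i => pdEnd n i ^ m i).prod F)
      (AddMonoidAlgebra.coeff g) := by
  rw [Finsupp.linearCombination_apply, sum_def]
  rfl

lemma diamond_sum {n : ℕ} {ι : Type*} (s : Finset ι) (g : ι → MvPolynomial (Fin n) ℂ)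
    (F : MvPolynomial (Fin n) ℂ) : diamond (∑ k ∈ s, g k) F = ∑ k ∈ s, diamond (g k) F := by
  simp only [diamond_eq_linearCombination, AddMonoidAlgebra.coeff_sum, map_sum]

lemma diamond_monomial {n : ℕ} (m : Fin n →₀ ℕ) (c : ℂ) (F : MvPolynomial (Fin n) ℂ) :
    diamond (monomial m c) F = c • (List.ofFn fun i => pdEnd n i ^ m i).prod F := by
  rw [diamond_eq_linearCombination]
  exact Finsupp.linearCombination_single ℂ c m

lemma diamond_binForm_dividedForm (n r : ℕ) (c : Fin (n + 1) → ℂ) (a : ℕ → ℂ) :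
    diamond (binForm n c) (dividedForm (r + n) a) =
      ((r + n).descFactorial n : ℂ) • dividedForm r fun j => ∑ k, c k * a (j + k) := by
  rw [binForm_apply, diamond_sum, ← sum_smul_dividedForm, Finset.smul_sum]
  refine Finset.sum_congr rfl fun k _ => ?_
  obtain ⟨p, hp⟩ := Nat.exists_eq_add_of_le (Nat.lt_succ_iff.mp k.is_lt)
  rw [diamond_monomial, List.ofFn_succ, List.ofFn_succ, List.ofFn_zero, List.prod_cons,
    List.prod_cons, List.prod_nil, mul_one, Module.End.mul_apply]
  simp only [Fin.succ_zero_eq_one, binExp_zero, binExp_one]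
  rw [show n - (k : ℕ) = p by omega, show r + n = (r + p) + k by omega,
    pdEnd_one_pow_dividedForm, map_smul, pdEnd_zero_pow_dividedForm, smul_smul, smul_smul,
    smul_smul]
  congr 1
  have h : (r + p + k).descFactorial n =
      (r + p + k).descFactorial k * (r + p).descFactorial p := by
    rw [← Nat.descFactorial_mul_descFactorial (show (k : ℕ) ≤ n by omega), Nat.add_sub_cancel,
      show n - (k : ℕ) = p by omega, mul_comm]
  rw [h]
  push_cast
  ring

lemma diamond_binForm_dividedForm_eq_zero_iff (n r : ℕ) (c : Fin (n + 1) → ℂ) (a : ℕ → ℂ) :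
    diamond (binForm n c) (dividedForm (r + n) a) = 0 ↔
      ∀ j ≤ r, ∑ k, c k * a (j + k) = 0 := by
  have : ((r + n).descFactorial n : ℂ) ≠ 0 := by
    simp [Nat.descFactorial_eq_zero_iff_lt]
  rw [diamond_binForm_dividedForm, smul_eq_zero_iff_right this, dividedForm_eq_zero_iff]

end Apolarity

section Hankel

/-- The `r × n` Hankel matrix of a sequence, as the linear map sending `c` to
`j ↦ ∑ k, c k * a (j + k)`. -/
noncomputable def hankelMap (n r : ℕ) (a : ℕ → ℂ) : (Fin n → ℂ) →ₗ[ℂ] (Fin r → ℂ) :=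
  (Matrix.of fun (j : Fin r) (k : Fin n) => a (j + k)).mulVecLin

lemma hankelMap_apply (n r : ℕ) (a : ℕ → ℂ) (c : Fin n → ℂ) (j : Fin r) :
    hankelMap n r a c j = ∑ k : Fin n, c k * a (j + k) := by
  simp [hankelMap, Matrix.mulVec, dotProduct, mul_comm]

lemma mem_ker_hankelMap {n r : ℕ} {a : ℕ → ℂ} {c : Fin n → ℂ} :
    c ∈ (hankelMap n r a).ker ↔ ∀ j < r, ∑ k : Fin n, c k * a (j + k) = 0 := by
  rw [LinearMap.mem_ker, funext_iff]
  simp only [hankelMap_apply, Pi.zero_apply]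
  exact ⟨fun h j hj => h ⟨j, hj⟩, fun h j => h j j.is_lt⟩

lemma hankelMap_injective_iff (n : ℕ) (a : ℕ → ℂ) :
    Function.Injective (hankelMap n n a) ↔
      Matrix.det (Matrix.of fun i j : Fin n => a ((i : ℕ) + (j : ℕ))) ≠ 0 := by
  rw [← LinearMap.ker_eq_bot, Ne, ← Matrix.exists_mulVec_eq_zero_iff, LinearMap.ker_eq_bot']
  push Not
  exact ⟨fun h v hv h0 => hv (h v h0), fun h v h0 => by_contra fun hv => h v hv h0⟩

lemma hankelMap_snoc_zero (n r : ℕ) (a : ℕ → ℂ) (c : Fin n → ℂ) (j : Fin r) :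
    hankelMap (n + 1) r a (Fin.snoc c 0 : Fin (n + 1) → ℂ) j = hankelMap n r a c j := by
  simp [hankelMap_apply, Fin.sum_univ_castSucc]

lemma hankelMap_cons_zero (n r : ℕ) (a : ℕ → ℂ) (c : Fin n → ℂ) (j : Fin r) :
    hankelMap (n + 1) r a (Fin.cons 0 c : Fin (n + 1) → ℂ) j =
      hankelMap n (r + 1) a c j.succ := by
  simp only [hankelMap_apply, Fin.sum_univ_succ, Fin.cons_zero, zero_mul, zero_add, Fin.cons_succ,
    Fin.val_succ]
  exact Finset.sum_congr rfl fun k _ => by rw [add_right_comm, add_assoc]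

lemma hankelMap_surjective {N : ℕ} {a : ℕ → ℂ}
    (h : Function.Injective (hankelMap (N + 1) (N + 1) a)) :
    Function.Surjective (hankelMap (N + 2) N a) := fun w => by
  obtain ⟨c, hc⟩ := LinearMap.surjective_of_injective h (Fin.snoc w 0)
  refine ⟨Fin.snoc c 0, funext fun j => ?_⟩
  rw [hankelMap_snoc_zero]
  have := congrFun hc j.castSucc
  rw [Fin.snoc_castSucc] at this
  rw [← this]
  simp only [hankelMap_apply, Fin.val_castSucc]

lemma finrank_ker_hankelMap {N : ℕ} {a : ℕ → ℂ}
    (h : Function.Injective (hankelMap (N + 1) (N + 1) a)) :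
    Module.finrank ℂ (hankelMap (N + 2) N a).ker = 2 := by
  have := (hankelMap (N + 2) N a).finrank_range_add_finrank_ker
  rw [LinearMap.range_eq_top.mpr (hankelMap_surjective h), finrank_top, Module.finrank_fin_fun,
    Module.finrank_fin_fun] at this
  omega

/-- A linear form on coefficient vectors that vanishes on the kernel of a Hankel map is a
combination of the rows of the Hankel matrix. -/
lemma exists_eq_sum_of_ker_hankelMap {n r : ℕ} {a : ℕ → ℂ} {v : Fin n → ℂ}
    (hv : ∀ c ∈ (hankelMap n r a).ker, ∑ k, c k * v k = 0) :
    ∃ γ : Fin r → ℂ, v = hankelMap r n a γ := by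
  let φ : Module.Dual ℂ (Fin n → ℂ) := ∑ k, v k • LinearMap.proj k
  have hφ : ∀ c, φ c = ∑ k, c k * v k := fun c => by simp [φ, mul_comm]
  have hmem : φ ∈ (hankelMap n r a).ker.dualAnnihilator := by
    rw [Submodule.mem_dualAnnihilator]
    exact fun c hc => (hφ c).trans (hv c hc)
  rw [← LinearMap.range_dualMap_eq_dualAnnihilator_ker] at hmem
  obtain ⟨ψ, hψ⟩ := hmem
  refine ⟨fun j => ψ (Pi.single j 1), funext fun k => ?_⟩
  have hk : φ (Pi.single k 1) = v k := by
    rw [hφ, Finset.sum_eq_single k] <;> simp +contextual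
  rw [← hk, ← hψ, LinearMap.dualMap_apply, hankelMap_apply,
    ← Finset.univ_sum_single (hankelMap n r a (Pi.single k 1)), map_sum]
  refine Finset.sum_congr rfl fun j _ => ?_
  have hj : hankelMap n r a (Pi.single k 1) j = a (k + j) := by
    rw [hankelMap_apply, Finset.sum_eq_single k] <;>
      simp +contextual [add_comm]
  rw [hj, mul_comm, ← smul_eq_mul, ← map_smul, ← Pi.single_smul, smul_eq_mul, mul_one]

/-- Multiplying a binary form by a nonzero linear form is injective. -/
lemma eq_zero_of_linear_mul_eq_zero {N : ℕ} {γ : Fin N → ℂ} {x y : ℂ} (hxy : x ≠ 0 ∨ y ≠ 0)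
    (h : y • (Fin.snoc γ 0 : Fin (N + 1) → ℂ) - x • (Fin.cons 0 γ : Fin (N + 1) → ℂ) = 0) :
    γ = 0 := by
  by_cases hy : y = 0
  · have hx : x ≠ 0 := hxy.resolve_right (not_not.mpr hy)
    ext j
    simpa [hy, hx] using congrFun h j.succ
  · have key : ∀ j (hj : j < N), γ ⟨j, hj⟩ = 0 := by
      intro j
      induction j with
      | zero =>
        intro hj
        have h0 := congrFun h (Fin.castSucc ⟨0, hj⟩)
        have hc : Fin.castSucc (⟨0, hj⟩ : Fin N) = 0 := rfl
        rw [Pi.sub_apply, Pi.smul_apply, Pi.smul_apply, Fin.snoc_castSucc, hc, Fin.cons_zero] at h0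
        simpa [hy] using h0
      | succ j ih =>
        intro hj
        have h0 := congrFun h (Fin.castSucc ⟨j + 1, hj⟩)
        have hc : Fin.castSucc (⟨j + 1, hj⟩ : Fin N) = Fin.succ ⟨j, by omega⟩ := rfl
        rw [Pi.sub_apply, Pi.smul_apply, Pi.smul_apply, Fin.snoc_castSucc, hc, Fin.cons_succ,
          ih] at h0
        simpa [hy] using h0
    ext j
    exact key j j.is_lt

/-- If the Hankel matrix of size `N + 1` is nonsingular, no point of `ℂ² \ {0}` is a common zero of
the forms of degree `N + 1` with coefficients in the kernel of the `N × (N + 2)` Hankel matrix. -/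
lemma eq_zero_of_forall_eval_binForm_eq_zero {N : ℕ} {a : ℕ → ℂ}
    (h : Function.Injective (hankelMap (N + 1) (N + 1) a)) {p : Fin 2 → ℂ}
    (hp : ∀ c ∈ (hankelMap (N + 2) N a).ker, eval p (binForm (N + 1) c) = 0) : p = 0 := by
  simp only [eval_binForm] at hp
  obtain ⟨γ, hγ⟩ := exists_eq_sum_of_ker_hankelMap hp
  by_contra hne
  have hxy : p 0 ≠ 0 ∨ p 1 ≠ 0 := by
    by_contra! hcon
    exact hne (funext fun i => by fin_cases i <;> simp [hcon])
  have hγ0 : γ = 0 := by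
    refine eq_zero_of_linear_mul_eq_zero hxy (h ?_)
    rw [map_zero, map_sub, map_smul, map_smul]
    ext k
    have h1 := congrFun hγ k.castSucc
    have h2 := congrFun hγ k.succ
    rw [Pi.sub_apply, Pi.smul_apply, Pi.smul_apply, hankelMap_snoc_zero, hankelMap_cons_zero,
      ← h2, show hankelMap N (N + 1) a γ k = hankelMap N (N + 2) a γ k.castSucc by
        simp only [hankelMap_apply, Fin.val_castSucc], ← h1]
    have hk : N + 1 - (k : ℕ) = N - k + 1 := by have := k.is_lt; omega
    simp only [Fin.val_castSucc, Fin.val_succ, Nat.add_sub_add_right, hk, smul_eq_mul,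
      Pi.zero_apply]
    ring
  rw [hγ0, map_zero] at hγ
  have h0 := congrFun hγ 0
  have h1 := congrFun hγ (Fin.last _)
  simp only [Fin.val_zero, Fin.val_last, Nat.sub_self, pow_zero, mul_one, one_mul, Nat.sub_zero,
    Pi.zero_apply] at h0 h1
  exact hxy.elim (fun hx => hx (eq_zero_of_pow_eq_zero h0)) fun hy => hy (eq_zero_of_pow_eq_zero h1)

end Hankel

lemma linearIndependent_X_mul {h : MvPolynomial (Fin 2) ℂ} (hh : h ≠ 0) :
    LinearIndependent ℂ ![X 0 * h, X 1 * h] := by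
  rw [LinearIndependent.pair_iff]
  intro s t hst
  have hlin : C s * X 0 + C t * X 1 = (0 : MvPolynomial (Fin 2) ℂ) := by
    refine (mul_eq_zero.mp ?_).resolve_right hh
    rw [smul_eq_C_mul, smul_eq_C_mul] at hst
    linear_combination hst
  have hev (x y : ℂ) : s * x + t * y = 0 := by
    simpa using congrArg (eval ![x, y]) hlin
  exact ⟨by simpa using hev 1 0, by simpa using hev 0 1⟩

lemma span_range_eq_of_forall_mem {V : Type*} [AddCommGroup V] [Module ℂ V] {f g : Fin 2 → V}
    (hf : LinearIndependent ℂ f) (hg : LinearIndependent ℂ g)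
    (h : ∀ i, g i ∈ Submodule.span ℂ (Set.range f)) :
    Submodule.span ℂ (Set.range g) = Submodule.span ℂ (Set.range f) := by
  have : FiniteDimensional ℂ (Submodule.span ℂ (Set.range f)) :=
    FiniteDimensional.span_of_finite ℂ (Set.finite_range f)
  refine Submodule.eq_of_le_of_finrank_eq (Submodule.span_le.mpr ?_) ?_
  · rintro _ ⟨i, rfl⟩
    exact h i
  · rw [finrank_span_eq_card hf, finrank_span_eq_card hg]

/-- For `d ≥ 3`, `N = d - 2`, and a binary form
`F = Σ_{i=0}^{2N} binom(2N,i)·a_i·e_1^{2N-i}e_2^i` of degree `2N`, the catalecticant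
(the determinant of the `(N+1)×(N+1)` Hankel matrix `(a_{i+j})`) is nonzero iff
`F^⊥ ∩ ℂ[z_1,z_2]_{d-1}` is 2-dimensional and admits a basis whose only common zero
in `ℂ²` is the origin. -/
theorem catalecticant_ne_zero_iff
    (d : ℕ) (hd : 3 ≤ d) (N : ℕ) (hN : N = d - 2) (a : ℕ → ℂ) :
    letI F : MvPolynomial (Fin 2) ℂ :=
      ∑ i ∈ Finset.range (2 * N + 1),
        C ((Nat.choose (2 * N) i : ℂ) * a i) * X 0 ^ (2 * N - i) * X 1 ^ i
    letI cat : ℂ := Matrix.det (Matrix.of fun i j : Fin (N + 1) => a ((i : ℕ) + (j : ℕ)))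
    (cat ≠ 0 ↔
      ∃ f : Fin 2 → MvPolynomial (Fin 2) ℂ,
        LinearIndependent ℂ f
          ∧ (∀ i, (f i).IsHomogeneous (d - 1))
          ∧ (∀ i, diamond (f i) F = 0)
          ∧ (∀ g : MvPolynomial (Fin 2) ℂ,
              g.IsHomogeneous (d - 1) → diamond g F = 0 →
                g ∈ Submodule.span ℂ (Set.range f))
          ∧ (∀ p : Fin 2 → ℂ, (∀ i, eval p (f i) = 0) → p = 0)) := by
  obtain ⟨rfl⟩ : d = N + 2 := by omega
  have hN0 : N ≠ 0 := by omega
  rw [← hankelMap_injective_iff, show N + 2 - 1 = N + 1 by omega]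
  change _ ↔ ∃ f : Fin 2 → MvPolynomial (Fin 2) ℂ, LinearIndependent ℂ f ∧ _ ∧
    (∀ i, diamond (f i) (dividedForm (2 * N) a) = 0) ∧
    (∀ g : MvPolynomial (Fin 2) ℂ, g.IsHomogeneous (N + 1) →
      diamond g (dividedForm (2 * N) a) = 0 → _) ∧ _
  have hker (c : Fin (N + 2) → ℂ) : diamond (binForm (N + 1) c) (dividedForm (2 * N) a) = 0 ↔
      c ∈ (hankelMap (N + 2) N a).ker := by
    rw [show 2 * N = N - 1 + (N + 1) by omega, diamond_binForm_dividedForm_eq_zero_iff,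
      mem_ker_hankelMap]
    exact forall_congr' fun j => by rw [Nat.le_sub_one_iff_lt (Nat.pos_of_ne_zero hN0)]
  constructor
  · intro h
    let b := Module.finBasisOfFinrankEq ℂ _ (finrank_ker_hankelMap h)
    have hspan (c) (hc : c ∈ (hankelMap (N + 2) N a).ker) : binForm (N + 1) c ∈
        Submodule.span ℂ (Set.range fun i => binForm (N + 1) (b i)) := by
      have hsum := congrArg (fun x => binForm (N + 1) x.1) (b.sum_repr ⟨c, hc⟩)
      simp only [Submodule.coe_sum, Submodule.coe_smul, map_sum, map_smul] at hsum
      rw [← hsum]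
      exact Submodule.sum_mem _ fun i _ =>
        Submodule.smul_mem _ _ (Submodule.subset_span ⟨i, rfl⟩)
    refine ⟨fun i => binForm (N + 1) (b i), ?_, fun i => isHomogeneous_binForm _ _,
      fun i => (hker _).mpr (b i).2, ?_, ?_⟩
    · refine b.linearIndependent.map' (binForm (N + 1) ∘ₗ (hankelMap (N + 2) N a).ker.subtype) ?_
      rw [LinearMap.ker_eq_bot]
      exact (binForm_injective _).comp Subtype.val_injective
    · intro g hg hgF
      obtain ⟨c, rfl⟩ := exists_binForm_eq hg
      exact hspan c ((hker c).mp hgF)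
    · intro p hp
      refine eq_zero_of_forall_eval_binForm_eq_zero h fun c hc => ?_
      have hle : Submodule.span ℂ (Set.range fun i => binForm (N + 1) (b i)) ≤
          (aeval p : MvPolynomial (Fin 2) ℂ →ₐ[ℂ] ℂ).toLinearMap.ker := by
        rw [Submodule.span_le]
        rintro _ ⟨i, rfl⟩
        simpa [aeval_eq_eval] using hp i
      simpa [aeval_eq_eval] using hle (hspan c hc)
  · rintro ⟨f, hf, -, -, hfspan, hf0⟩
    by_contra hinj
    rw [← LinearMap.ker_eq_bot, Submodule.eq_bot_iff] at hinj
    push Not at hinj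
    obtain ⟨c, hc, hc0⟩ := hinj
    have hh : binForm N c ≠ 0 := (map_ne_zero_iff _ (binForm_injective N)).mpr hc0
    have hc' := mem_ker_hankelMap.mp hc
    have hmem : ∀ i, ![X 0 * binForm N c, X 1 * binForm N c] i ∈
        Submodule.span ℂ (Set.range f) := by
      intro i
      fin_cases i
      · change X 0 * binForm N c ∈ _
        rw [X_zero_mul_binForm]
        refine hfspan _ (isHomogeneous_binForm _ _) ((hker _).mpr (funext fun j => ?_))
        rw [hankelMap_snoc_zero, hankelMap_apply]
        exact hc' j (by omega)
      · change X 1 * binForm N c ∈ _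
        rw [X_one_mul_binForm]
        refine hfspan _ (isHomogeneous_binForm _ _) ((hker _).mpr (funext fun j => ?_))
        rw [hankelMap_cons_zero]
        exact congrFun hc j.succ
    have hspan := span_range_eq_of_forall_mem hf (linearIndependent_X_mul hh) hmem
    obtain ⟨p, hp0, hp⟩ := exists_ne_zero_eval_binForm_eq_zero hN0 c
    refine hp0 (hf0 p fun i => ?_)
    have hfi : f i ∈ Submodule.span ℂ (Set.range ![X 0 * binForm N c, X 1 * binForm N c]) :=
      hspan ▸ Submodule.subset_span ⟨i, rfl⟩
    rw [Matrix.range_cons_cons_empty, Submodule.mem_span_pair] at hfi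
    obtain ⟨s, t, hst⟩ := hfi
    simp [← hst, hp]
end

section
/- Let t ∈ ℂ with t² ≠ 4, and let q_t := z_1^4 + t·z_1²z_2² + z_2^4 ∈ ℂ[z_1,z_2]_4. Then q_t is nondegenerate, and the associated form of q_t equals (1/(72(t²−4)))·(t·e_1^4 − 12·e_1²e_2² + t·e_2^4). -/
open MvPolynomial

noncomputable section

/-- The gradient ideal `(f_{z_1},…,f_{z_n})` of a form `f`. -/
def gradIdeal (n : ℕ) (f : MvPolynomial (Fin n) ℂ) : Ideal (MvPolynomial (Fin n) ℂ) :=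
  Ideal.span (Set.range fun i => pderiv i f)

/-- The Hessian `det (∂²f/∂z_i∂z_j)` of a form `f`. -/
def hess (n : ℕ) (f : MvPolynomial (Fin n) ℂ) : MvPolynomial (Fin n) ℂ :=
  Matrix.det (Matrix.of fun i j : Fin n => pderiv i (pderiv j f))

/-- `μ` is the system of coefficients defining the associated form of `f`:
for each multi-index `m` with `|m| = n(d-2)`, the scalar `μ m` satisfies
`z^m - μ m · Hess f ∈ (f_{z_1},…,f_{z_n})`. -/
def IsAssocCoeffs (n d : ℕ) (f : MvPolynomial (Fin n) ℂ) (μ : (Fin n → ℕ) → ℂ) : Prop :=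
  ∀ m : Fin n → ℕ, (∑ i, m i) = n * (d - 2) →
    (∏ i, X i ^ m i) - C (μ m) * hess n f ∈ gradIdeal n f

end
/-- The constant term of the differential operator `t ∂₁⁴ - 12 ∂₁²∂₂² + t ∂₂⁴` applied to `p`. -/
noncomputable def apolarPairing (t : ℂ) (p : MvPolynomial (Fin 2) ℂ) : ℂ :=
  eval 0 (C t * pderiv 0 (pderiv 0 (pderiv 0 (pderiv 0 p)))
    - C 12 * pderiv 0 (pderiv 0 (pderiv 1 (pderiv 1 p)))
    + C t * pderiv 1 (pderiv 1 (pderiv 1 (pderiv 1 p))))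

lemma apolarPairing_add (t : ℂ) (p r : MvPolynomial (Fin 2) ℂ) :
    apolarPairing t (p + r) = apolarPairing t p + apolarPairing t r := by
  simp only [apolarPairing, map_add, map_sub, map_mul]
  ring

lemma apolarPairing_sub (t : ℂ) (p r : MvPolynomial (Fin 2) ℂ) :
    apolarPairing t (p - r) = apolarPairing t p - apolarPairing t r := by
  simp only [apolarPairing, map_add, map_sub, map_mul]
  ring

lemma apolarPairing_C_mul (t c : ℂ) (p : MvPolynomial (Fin 2) ℂ) :
    apolarPairing t (C c * p) = c * apolarPairing t p := by
  simp only [apolarPairing, pderiv_C_mul, map_add, map_sub, map_mul, eval_C]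
  ring

lemma C_ofNat_eq (n : ℕ) [n.AtLeastTwo] :
    (C (no_index (OfNat.ofNat n)) : MvPolynomial (Fin 2) ℂ) = OfNat.ofNat n :=
  map_ofNat C n

lemma ofNat_eq_C (n : ℕ) [n.AtLeastTwo] :
    (OfNat.ofNat n : MvPolynomial (Fin 2) ℂ) = C (OfNat.ofNat n) :=
  (C_ofNat_eq n).symm

lemma pderiv_zero_quartic (t : ℂ) :
    pderiv 0 (X 0 ^ 4 + C t * X 0 ^ 2 * X 1 ^ 2 + X 1 ^ 4 : MvPolynomial (Fin 2) ℂ)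
      = C 4 * X 0 ^ 3 + C (2 * t) * X 0 * X 1 ^ 2 := by
  simp [ofNat_eq_C, pderiv_X, Derivation.leibniz, Derivation.leibniz_pow]
  ring

lemma pderiv_one_quartic (t : ℂ) :
    pderiv 1 (X 0 ^ 4 + C t * X 0 ^ 2 * X 1 ^ 2 + X 1 ^ 4 : MvPolynomial (Fin 2) ℂ)
      = C 4 * X 1 ^ 3 + C (2 * t) * X 0 ^ 2 * X 1 := by
  simp [ofNat_eq_C, pderiv_X, Derivation.leibniz, Derivation.leibniz_pow]
  ring

lemma hess_quartic (t : ℂ) :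
    hess 2 (X 0 ^ 4 + C t * X 0 ^ 2 * X 1 ^ 2 + X 1 ^ 4)
      = C (24 * t) * X 0 ^ 4 + C (144 - 12 * t ^ 2) * (X 0 ^ 2 * X 1 ^ 2)
        + C (24 * t) * X 1 ^ 4 := by
  rw [hess, Matrix.det_fin_two]
  simp only [Matrix.of_apply, pderiv_zero_quartic, pderiv_one_quartic]
  simp [ofNat_eq_C, pderiv_X, Derivation.leibniz, Derivation.leibniz_pow]
  simp only [C_ofNat_eq]
  ring

lemma apolarPairing_mul_pderiv_zero (t : ℂ) (a : MvPolynomial (Fin 2) ℂ) :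
    apolarPairing t (a * (C 4 * X 0 ^ 3 + C (2 * t) * X 0 * X 1 ^ 2)) = 0 := by
  simp [apolarPairing, ofNat_eq_C, pderiv_X, Derivation.leibniz, Derivation.leibniz_pow]
  ring

lemma apolarPairing_mul_pderiv_one (t : ℂ) (a : MvPolynomial (Fin 2) ℂ) :
    apolarPairing t (a * (C 4 * X 1 ^ 3 + C (2 * t) * X 0 ^ 2 * X 1)) = 0 := by
  simp [apolarPairing, ofNat_eq_C, pderiv_X, Derivation.leibniz, Derivation.leibniz_pow]
  ring

lemma apolarPairing_eq_zero_of_mem_gradIdeal (t : ℂ) {p : MvPolynomial (Fin 2) ℂ}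
    (hp : p ∈ gradIdeal 2 (X 0 ^ 4 + C t * X 0 ^ 2 * X 1 ^ 2 + X 1 ^ 4)) :
    apolarPairing t p = 0 := by
  obtain ⟨c, rfl⟩ := Ideal.mem_span_range_iff_exists_fun.1 hp
  rw [Fin.sum_univ_two, pderiv_zero_quartic, pderiv_one_quartic, apolarPairing_add,
    apolarPairing_mul_pderiv_zero, apolarPairing_mul_pderiv_one, add_zero]

lemma apolarPairing_monomials (t : ℂ) :
    apolarPairing t (X 0 ^ 4) = 24 * t ∧ apolarPairing t (X 0 ^ 3 * X 1) = 0 ∧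
      apolarPairing t (X 0 ^ 2 * X 1 ^ 2) = -48 ∧ apolarPairing t (X 0 * X 1 ^ 3) = 0 ∧
      apolarPairing t (X 1 ^ 4) = 24 * t := by
  refine ⟨?_, ?_, ?_, ?_, ?_⟩ <;>
    simp [apolarPairing, ofNat_eq_C, pderiv_X, Derivation.leibniz, Derivation.leibniz_pow] <;> ring

lemma apolarPairing_hess_quartic (t : ℂ) :
    apolarPairing t (hess 2 (X 0 ^ 4 + C t * X 0 ^ 2 * X 1 ^ 2 + X 1 ^ 4))
      = 24 * (72 * (t ^ 2 - 4)) := by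
  obtain ⟨h40, -, h22, -, h04⟩ := apolarPairing_monomials t
  rw [hess_quartic, apolarPairing_add, apolarPairing_add, apolarPairing_C_mul,
    apolarPairing_C_mul, apolarPairing_C_mul, h40, h22, h04]
  ring

lemma IsAssocCoeffs.apolarPairing_eq {t : ℂ} {μ : (Fin 2 → ℕ) → ℂ}
    (hμ : IsAssocCoeffs 2 4 (X 0 ^ 4 + C t * X 0 ^ 2 * X 1 ^ 2 + X 1 ^ 4) μ)
    {i j : ℕ} (hij : i + j = 4) :
    apolarPairing t (X 0 ^ i * X 1 ^ j) = μ ![i, j] * (24 * (72 * (t ^ 2 - 4))) := by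
  have h := apolarPairing_eq_zero_of_mem_gradIdeal t (hμ ![i, j] (by simpa using hij))
  rw [apolarPairing_sub, apolarPairing_C_mul, apolarPairing_hess_quartic] at h
  simpa using sub_eq_zero.1 h

lemma quartic_nondegenerate {t : ℂ} (ht : t ^ 2 ≠ 4) (p : Fin 2 → ℂ)
    (hp : ∀ i, eval p (pderiv i
      (X 0 ^ 4 + C t * X 0 ^ 2 * X 1 ^ 2 + X 1 ^ 4 : MvPolynomial (Fin 2) ℂ)) = 0) :
    p = 0 := by
  have h0 := hp 0
  have h1 := hp 1
  rw [pderiv_zero_quartic] at h0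
  rw [pderiv_one_quartic] at h1
  simp only [map_add, map_mul, map_pow, eval_C, eval_X] at h0 h1
  have ht' : t ^ 2 - 4 ≠ 0 := sub_ne_zero.2 ht
  have hx : (t ^ 2 - 4) * p 0 ^ 5 = 0 := by
    linear_combination ((t ^ 2 - 4) / 4 * p 0 ^ 2 + t / 2 * p 1 ^ 2) * h0
      - t ^ 2 / 4 * p 0 * p 1 * h1
  have hy : (t ^ 2 - 4) * p 1 ^ 5 = 0 := by
    linear_combination ((t ^ 2 - 4) / 4 * p 1 ^ 2 + t / 2 * p 0 ^ 2) * h1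
      - t ^ 2 / 4 * p 0 * p 1 * h0
  have hx0 : p 0 = 0 := by simpa [ht'] using hx
  have hy0 : p 1 = 0 := by simpa [ht'] using hy
  ext i
  fin_cases i <;> simp [hx0, hy0]

/-- For `t² ≠ 4`, the binary quartic `q_t = z_1⁴ + t z_1²z_2² + z_2⁴` is
nondegenerate and its associated form is `(1/(72(t²-4)))(t e_1⁴ - 12 e_1²e_2² + t e_2⁴)`. -/
theorem assocForm_of_binary_quartic_qt
    (t : ℂ) (ht : t ^ 2 ≠ 4) :
    letI q : MvPolynomial (Fin 2) ℂ := X 0 ^ 4 + C t * X 0 ^ 2 * X 1 ^ 2 + X 1 ^ 4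
    (∀ p : Fin 2 → ℂ, (∀ i, eval p (pderiv i q) = 0) → p = 0)
      ∧ ∀ μ : (Fin 2 → ℕ) → ℂ, IsAssocCoeffs 2 4 q μ →
          assocForm 2 4 μ
            = C (1 / (72 * (t ^ 2 - 4)))
                * (C t * X 0 ^ 4 - C 12 * X 0 ^ 2 * X 1 ^ 2 + C t * X 1 ^ 4) := by
  refine ⟨quartic_nondegenerate ht, fun μ hμ => ?_⟩
  have ht' : t ^ 2 - 4 ≠ 0 := sub_ne_zero.2 ht
  obtain ⟨h40, h31, h22, h13, h04⟩ := apolarPairing_monomials t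
  have e40 : μ ![4, 0] = t / (72 * (t ^ 2 - 4)) := by
    have h := hμ.apolarPairing_eq (i := 4) (j := 0) rfl
    rw [pow_zero, mul_one, h40] at h
    field_simp
    linear_combination -h / 24
  have e31 : μ ![3, 1] = 0 := by
    have h := hμ.apolarPairing_eq (i := 3) (j := 1) rfl
    rw [pow_one, h31] at h
    simpa [ht'] using h.symm
  have e22 : μ ![2, 2] = -2 / (72 * (t ^ 2 - 4)) := by
    have h := hμ.apolarPairing_eq (i := 2) (j := 2) rfl
    rw [h22] at h
    field_simp
    linear_combination -h / 24
  have e13 : μ ![1, 3] = 0 := by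
    have h := hμ.apolarPairing_eq (i := 1) (j := 3) rfl
    rw [pow_one, h13] at h
    simpa [ht'] using h.symm
  have e04 : μ ![0, 4] = t / (72 * (t ^ 2 - 4)) := by
    have h := hμ.apolarPairing_eq (i := 0) (j := 4) rfl
    rw [pow_zero, one_mul, h04] at h
    field_simp
    linear_combination -h / 24
  have hset : Finset.Nat.antidiagonalTuple 2 (2 * (4 - 2))
      = {![4, 0], ![3, 1], ![2, 2], ![1, 3], ![0, 4]} := by decide
  have m40 : Nat.multinomial Finset.univ ![4, 0] = 1 := by decide
  have m22 : Nat.multinomial Finset.univ ![2, 2] = 6 := by decide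
  have m04 : Nat.multinomial Finset.univ ![0, 4] = 1 := by decide
  rw [assocForm, hset]
  simp [e40, e31, e22, e13, e04, m40, m22, m04, div_eq_mul_inv, C_ofNat_eq]
  ring
end

section
/- Let t ∈ ℂ with t ≠ 0, t² ≠ 4 and t² ≠ 36, and let g_t := t·z_1^4 − 12·z_1²z_2² + t·z_2^4 ∈ ℂ[z_1,z_2]_4. Then g_t is nondegenerate, and the associated form of g_t is a nonzero scalar multiple of q_t := e_1^4 + t·e_1²e_2² + e_2^4. (Thus for binary quartics the square of the projectivized associated-form map is the identity on the orbit of q_t.) -/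
open MvPolynomial

theorem pderiv_ofNat {σ R : Type*} [CommSemiring R] (i : σ) (n : ℕ) [n.AtLeastTwo] :
    pderiv i (ofNat(n) : MvPolynomial σ R) = 0 := by
  rw [← map_ofNat C n, pderiv_C]

/-- The apolar pairing with `e_1⁴ + t e_1²e_2² + e_2⁴`: the linear functional
`p ↦ ((∂_1⁴ + t ∂_1²∂_2² + ∂_2⁴) p)(0)`. -/
noncomputable def apolarQuartic (t : ℂ) : MvPolynomial (Fin 2) ℂ →ₗ[ℂ] ℂ :=
  let D (i : Fin 2) : MvPolynomial (Fin 2) ℂ →ₗ[ℂ] MvPolynomial (Fin 2) ℂ := (pderiv i).toLinearMap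
  (aeval (0 : Fin 2 → ℂ)).toLinearMap ∘ₗ
    (D 0 ∘ₗ D 0 ∘ₗ D 0 ∘ₗ D 0 + t • (D 0 ∘ₗ D 0 ∘ₗ D 1 ∘ₗ D 1) + D 1 ∘ₗ D 1 ∘ₗ D 1 ∘ₗ D 1)

theorem apolarQuartic_apply (t : ℂ) (p : MvPolynomial (Fin 2) ℂ) :
    apolarQuartic t p =
      eval 0 (pderiv 0 (pderiv 0 (pderiv 0 (pderiv 0 p)))) +
        t * eval 0 (pderiv 0 (pderiv 0 (pderiv 1 (pderiv 1 p)))) +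
        eval 0 (pderiv 1 (pderiv 1 (pderiv 1 (pderiv 1 p)))) := by
  simp [apolarQuartic, aeval_eq_eval]

/-- The binary quartic `t z_1⁴ - 12 z_1²z_2² + t z_2⁴`. -/
noncomputable abbrev quarticG (t : ℂ) : MvPolynomial (Fin 2) ℂ :=
  C t * X 0 ^ 4 - C 12 * X 0 ^ 2 * X 1 ^ 2 + C t * X 1 ^ 4

theorem pderiv_zero_quarticG (t : ℂ) :
    pderiv 0 (quarticG t) = 4 * C t * X 0 ^ 3 - 24 * X 0 * X 1 ^ 2 := by
  simp [quarticG, pderiv_X, pderiv_ofNat, map_ofNat C 12]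
  ring

theorem pderiv_one_quarticG (t : ℂ) :
    pderiv 1 (quarticG t) = 4 * C t * X 1 ^ 3 - 24 * X 0 ^ 2 * X 1 := by
  simp [quarticG, pderiv_X, pderiv_ofNat, map_ofNat C 12]
  ring

theorem hess_quarticG (t : ℂ) :
    hess 2 (quarticG t) =
      144 * (C t ^ 2 - 12) * (X 0 ^ 2 * X 1 ^ 2) - 288 * C t * X 0 ^ 4
        - 288 * C t * X 1 ^ 4 := by
  simp only [hess, Matrix.det_fin_two, Matrix.of_apply, pderiv_zero_quarticG,
    pderiv_one_quarticG]
  simp [pderiv_X, pderiv_ofNat]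
  ring

theorem apolarQuartic_eq_zero_of_mem (t : ℂ) {p : MvPolynomial (Fin 2) ℂ}
    (hp : p ∈ gradIdeal 2 (quarticG t)) : apolarQuartic t p = 0 := by
  have hr : (Set.range fun i => pderiv i (quarticG t)) =
      {pderiv 0 (quarticG t), pderiv 1 (quarticG t)} := by
    ext; simp [Fin.exists_fin_two, eq_comm]
  rw [gradIdeal, hr, Ideal.mem_span_pair] at hp
  obtain ⟨a, b, rfl⟩ := hp
  rw [pderiv_zero_quarticG, pderiv_one_quarticG, apolarQuartic_apply]
  simp [pderiv_X, pderiv_ofNat, map_ofNat]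
  ring

/-- For `t ≠ 0`, `t² ≠ 4`, `t² ≠ 36`, the binary quartic
`g_t = t z_1⁴ - 12 z_1²z_2² + t z_2⁴` is nondegenerate and its associated form is a nonzero
scalar multiple of `q_t = e_1⁴ + t e_1²e_2² + e_2⁴`. -/
theorem assocForm_of_binary_quartic_gt
    (t : ℂ) (ht0 : t ≠ 0) (ht4 : t ^ 2 ≠ 4) (ht36 : t ^ 2 ≠ 36) :
    letI g : MvPolynomial (Fin 2) ℂ := C t * X 0 ^ 4 - C 12 * X 0 ^ 2 * X 1 ^ 2 + C t * X 1 ^ 4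
    (∀ p : Fin 2 → ℂ, (∀ i, eval p (pderiv i g) = 0) → p = 0)
      ∧ ∀ μ : (Fin 2 → ℕ) → ℂ, IsAssocCoeffs 2 4 g μ →
          ∃ c : ℂ, c ≠ 0 ∧
            assocForm 2 4 μ = c • (X 0 ^ 4 + C t * X 0 ^ 2 * X 1 ^ 2 + X 1 ^ 4) := by
  refine ⟨fun p hp => ?_, fun μ hμ => ?_⟩
  · have h0 := hp 0
    have h1 := hp 1
    rw [pderiv_zero_quarticG] at h0
    rw [pderiv_one_quarticG] at h1
    simp at h0 h1
    have ht : t ^ 2 - 36 ≠ 0 := sub_ne_zero.2 ht36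
    have hx : p 0 = 0 := by
      by_contra hx
      have e0 : t * p 0 ^ 2 = 6 * p 1 ^ 2 := by
        apply mul_left_cancel₀ hx; linear_combination h0 / 4
      have hy : p 1 ≠ 0 := by
        intro hy; simp [hy, ht0, hx] at e0
      have e1 : t * p 1 ^ 2 = 6 * p 0 ^ 2 := by
        apply mul_left_cancel₀ hy; linear_combination h1 / 4
      have : (t ^ 2 - 36) * p 0 ^ 2 = 0 := by linear_combination t * e0 + 6 * e1
      simp [ht, hx] at this
    have hy : p 1 = 0 := by simpa [hx, ht0] using h1
    ext i; fin_cases i <;> simp [hx, hy]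
  · have key (a b : ℕ) (hab : a + b = 4) :
        apolarQuartic t (X 0 ^ a * X 1 ^ b) = μ ![a, b] * (576 * t * (t ^ 2 - 36)) := by
      have h := apolarQuartic_eq_zero_of_mem t (hμ ![a, b] (by simpa using hab))
      have hH : apolarQuartic t (hess 2 (quarticG t)) = 576 * t * (t ^ 2 - 36) := by
        rw [hess_quarticG, apolarQuartic_apply]
        simp [pderiv_X, pderiv_ofNat, map_ofNat]
        ring
      rw [map_sub, C_mul', map_smul, hH, sub_eq_zero] at h
      simpa using h
    have ht : 576 * t * (t ^ 2 - 36) ≠ 0 := by simp [ht0, sub_ne_zero.2 ht36]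
    have k40 := key 4 0 rfl
    have k31 := key 3 1 rfl
    have k22 := key 2 2 rfl
    have k13 := key 1 3 rfl
    have k04 := key 0 4 rfl
    simp [apolarQuartic_apply, pderiv_X, pderiv_ofNat, map_ofNat, ht0, sub_ne_zero.2 ht36] at k40 k31 k22 k13 k04
    refine ⟨μ ![4, 0], ?_, ?_⟩
    · rintro h
      simp [h] at k40
    have hs : Finset.Nat.antidiagonalTuple 2 (2 * (4 - 2)) =
        {![0, 4], ![1, 3], ![2, 2], ![3, 1], ![4, 0]} := by decide
    have h04 : μ ![0, 4] = μ ![4, 0] := mul_right_cancel₀ ht (k04.symm.trans k40)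
    have h22 : 6 * μ ![2, 2] = μ ![4, 0] * t := by
      apply mul_right_cancel₀ ht
      linear_combination t * k40 - 6 * k22
    have m04 : Nat.multinomial Finset.univ ![0, 4] = 1 := by decide
    have m22 : Nat.multinomial Finset.univ ![2, 2] = 6 := by decide
    have m40 : Nat.multinomial Finset.univ ![4, 0] = 1 := by decide
    have hC : 6 * C (μ ![2, 2]) = C (μ ![4, 0]) * (C t : MvPolynomial (Fin 2) ℂ) := by
      rw [← C_mul, ← h22, C_mul, map_ofNat]
    simp [assocForm, hs, k31, k13, h04, m04, m22, m40, smul_eq_C_mul]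
    linear_combination (X 0 ^ 2 * X 1 ^ 2) * hC
end

section
/- Let t ∈ ℂ with t ≠ 0, t³ ≠ −27 and t³ ≠ 216, and let h_t := t·z_1³ + t·z_2³ + t·z_3³ − 18·z_1z_2z_3 ∈ ℂ[z_1,z_2,z_3]_3. Then h_t is nondegenerate, and the associated form of h_t is a nonzero scalar multiple of c_t := e_1³ + e_2³ + e_3³ + t·e_1e_2e_3. (Thus for ternary cubics the square of the projectivized associated-form map is the identity on the orbit of c_t.) -/
open MvPolynomial

/-- The linear functional `p ↦ (t ∂₀∂₁∂₂ + ∂₀³ + ∂₁³ + ∂₂³) p (0)` on ternary polynomials,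
i.e. pairing with the cubic `e₁³ + e₂³ + e₃³ + t e₁e₂e₃`. -/
noncomputable def hessePairing (t : ℂ) : MvPolynomial (Fin 3) ℂ →ₗ[ℂ] ℂ where
  toFun p := t * eval 0 (pderiv 0 (pderiv 1 (pderiv 2 p)))
    + ∑ i, eval 0 (pderiv i (pderiv i (pderiv i p)))
  map_add' p q := by simp only [map_add, Finset.sum_add_distrib]; ring
  map_smul' a p := by
    simp only [Derivation.map_smul, smul_eval, ← Finset.mul_sum, RingHom.id_apply, smul_eq_mul]
    ring

theorem hessePairing_apply (t : ℂ) (p : MvPolynomial (Fin 3) ℂ) :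
    hessePairing t p = t * eval 0 (pderiv 0 (pderiv 1 (pderiv 2 p)))
      + ∑ i, eval 0 (pderiv i (pderiv i (pderiv i p))) := rfl

/-- The ternary cubic `t z₁³ + t z₂³ + t z₃³ - 18 z₁z₂z₃`. -/
noncomputable def hesseCubic (t : ℂ) : MvPolynomial (Fin 3) ℂ :=
  C t * X 0 ^ 3 + C t * X 1 ^ 3 + C t * X 2 ^ 3 - C 18 * (X 0 * X 1 * X 2)

theorem pderiv_zero_hesseCubic (t : ℂ) :
    pderiv 0 (hesseCubic t) = C (3 * t) * X 0 ^ 2 - C 18 * (X 1 * X 2) := by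
  simp [hesseCubic, Derivation.leibniz_pow, pderiv_X, pderiv_ofNat, map_ofNat C]
  ring

theorem pderiv_one_hesseCubic (t : ℂ) :
    pderiv 1 (hesseCubic t) = C (3 * t) * X 1 ^ 2 - C 18 * (X 0 * X 2) := by
  simp [hesseCubic, Derivation.leibniz_pow, pderiv_X, pderiv_ofNat, map_ofNat C]
  ring

theorem pderiv_two_hesseCubic (t : ℂ) :
    pderiv 2 (hesseCubic t) = C (3 * t) * X 2 ^ 2 - C 18 * (X 0 * X 1) := by
  simp [hesseCubic, Derivation.leibniz_pow, pderiv_X, pderiv_ofNat, map_ofNat C]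
  ring

theorem hesseCubic_nondegenerate {t : ℂ} (ht0 : t ≠ 0) (ht216 : t ^ 3 ≠ 216) (p : Fin 3 → ℂ)
    (hp : ∀ i, eval p (pderiv i (hesseCubic t)) = 0) : p = 0 := by
  have h0 := hp 0
  have h1 := hp 1
  have h2 := hp 2
  rw [pderiv_zero_hesseCubic] at h0
  rw [pderiv_one_hesseCubic] at h1
  rw [pderiv_two_hesseCubic] at h2
  simp only [map_sub, map_mul, map_pow, eval_C, eval_X] at h0 h1 h2
  have e0 : t * p 0 ^ 2 = 6 * (p 1 * p 2) := by linear_combination h0 / 3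
  have e1 : t * p 1 ^ 2 = 6 * (p 0 * p 2) := by linear_combination h1 / 3
  have e2 : t * p 2 ^ 2 = 6 * (p 0 * p 1) := by linear_combination h2 / 3
  have hprod : (t ^ 3 - 216) * (p 0 * p 1 * p 2) ^ 2 = 0 := by
    have : (t * p 0 ^ 2) * (t * p 1 ^ 2) * (t * p 2 ^ 2)
        = (6 * (p 1 * p 2)) * (6 * (p 0 * p 2)) * (6 * (p 0 * p 1)) := by rw [e0, e1, e2]
    linear_combination this
  have hxyz : p 0 * p 1 * p 2 = 0 := by
    simpa [sub_eq_zero, ht216] using hprod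
  have cube_zero (x : ℂ) (hx : t * x ^ 3 = 0) : x = 0 := by simpa [ht0] using hx
  funext i
  fin_cases i
  · exact cube_zero (p 0) (by linear_combination p 0 * e0 + 6 * hxyz)
  · exact cube_zero (p 1) (by linear_combination p 1 * e1 + 6 * hxyz)
  · exact cube_zero (p 2) (by linear_combination p 2 * e2 + 6 * hxyz)

theorem hessePairing_eq_zero_of_mem_gradIdeal {t : ℂ} {p : MvPolynomial (Fin 3) ℂ}
    (hp : p ∈ gradIdeal 3 (hesseCubic t)) : hessePairing t p = 0 := by
  obtain ⟨a, rfl⟩ := Submodule.mem_span_range_iff_exists_fun _ |>.1 hp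
  rw [map_sum]
  refine Finset.sum_eq_zero fun i _ => ?_
  fin_cases i
  · simp [pderiv_zero_hesseCubic, hessePairing_apply, Fin.sum_univ_three,
      Derivation.leibniz_pow, pderiv_X, pderiv_ofNat, map_ofNat constantCoeff]
    ring
  · simp [pderiv_one_hesseCubic, hessePairing_apply, Fin.sum_univ_three,
      Derivation.leibniz_pow, pderiv_X, pderiv_ofNat, map_ofNat constantCoeff]
    ring
  · simp [pderiv_two_hesseCubic, hessePairing_apply, Fin.sum_univ_three,
      Derivation.leibniz_pow, pderiv_X, pderiv_ofNat, map_ofNat constantCoeff]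
    ring

theorem hess_hesseCubic (t : ℂ) :
    hess 3 (hesseCubic t) = C (216 * t ^ 3 - 11664) * (X 0 * X 1 * X 2)
      - C (1944 * t) * (X 0 ^ 3 + X 1 ^ 3 + X 2 ^ 3) := by
  simp [hess, Matrix.det_fin_three, pderiv_zero_hesseCubic, pderiv_one_hesseCubic,
    pderiv_two_hesseCubic, Derivation.leibniz_pow, pderiv_X, pderiv_ofNat, map_ofNat C]
  ring

theorem hessePairing_hess (t : ℂ) :
    hessePairing t (hess 3 (hesseCubic t)) = 216 * t * (t ^ 3 - 216) := by
  simp [hess_hesseCubic, hessePairing_apply, Fin.sum_univ_three, Derivation.leibniz_pow, pderiv_X,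
    pderiv_ofNat, map_ofNat constantCoeff]
  ring

theorem assocCoeff_mul_eq_hessePairing {t : ℂ} {μ : (Fin 3 → ℕ) → ℂ}
    (hμ : IsAssocCoeffs 3 3 (hesseCubic t) μ) (m : Fin 3 → ℕ) (hm : ∑ i, m i = 3) :
    μ m * (216 * t * (t ^ 3 - 216)) = hessePairing t (∏ i, X i ^ m i) := by
  have h := hessePairing_eq_zero_of_mem_gradIdeal (hμ m hm)
  rw [map_sub, ← smul_eq_C_mul, map_smul, hessePairing_hess, sub_eq_zero] at h
  exact h.symm

/-- For `t ≠ 0`, `t³ ≠ -27`, `t³ ≠ 216`, the ternary cubic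
`h_t = t z_1³ + t z_2³ + t z_3³ - 18 z_1z_2z_3` is nondegenerate and its associated form is a
nonzero scalar multiple of `c_t = e_1³ + e_2³ + e_3³ + t e_1e_2e_3`. -/
theorem assocForm_of_ternary_cubic_ht
    (t : ℂ) (ht0 : t ≠ 0) (ht27 : t ^ 3 ≠ -27) (ht216 : t ^ 3 ≠ 216) :
    letI h : MvPolynomial (Fin 3) ℂ :=
      C t * X 0 ^ 3 + C t * X 1 ^ 3 + C t * X 2 ^ 3 - C 18 * (X 0 * X 1 * X 2)
    (∀ p : Fin 3 → ℂ, (∀ i, eval p (pderiv i h) = 0) → p = 0)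
      ∧ ∀ μ : (Fin 3 → ℕ) → ℂ, IsAssocCoeffs 3 3 h μ →
          ∃ c : ℂ, c ≠ 0 ∧
            assocForm 3 3 μ
              = c • (X 0 ^ 3 + X 1 ^ 3 + X 2 ^ 3 + C t * (X 0 * X 1 * X 2)) := by
  refine ⟨hesseCubic_nondegenerate ht0 ht216, fun μ hμ => ?_⟩
  have hK : 216 * t * (t ^ 3 - 216) ≠ 0 := by simp [ht0, sub_eq_zero, ht216]
  refine ⟨6 / (216 * t * (t ^ 3 - 216)), div_ne_zero (by norm_num) hK, ?_⟩
  have hμ' (m : Fin 3 → ℕ) (hm : m ∈ Finset.Nat.antidiagonalTuple 3 3) :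
      μ m = hessePairing t (∏ i, X i ^ m i) / (216 * t * (t ^ 3 - 216)) :=
    eq_div_of_mul_eq hK
      (assocCoeff_mul_eq_hessePairing hμ m (Finset.Nat.mem_antidiagonalTuple.1 hm))
  have htuples : Finset.Nat.antidiagonalTuple 3 3 =
      {![3, 0, 0], ![0, 3, 0], ![0, 0, 3], ![1, 1, 1], ![2, 1, 0], ![2, 0, 1], ![1, 2, 0],
        ![0, 2, 1], ![1, 0, 2], ![0, 1, 2]} := by decide
  have h300 : Nat.multinomial Finset.univ ![3, 0, 0] = 1 := by decide
  have h030 : Nat.multinomial Finset.univ ![0, 3, 0] = 1 := by decide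
  have h003 : Nat.multinomial Finset.univ ![0, 0, 3] = 1 := by decide
  have h111 : Nat.multinomial Finset.univ ![1, 1, 1] = 6 := by decide
  rw [assocForm, Finset.sum_congr rfl fun m hm => by rw [hμ' m hm]]
  generalize 216 * t * (t ^ 3 - 216) = K
  simp [htuples, h300, h030, h003, h111, smul_eq_C_mul, hessePairing_apply, Fin.sum_univ_three,
    Fin.prod_univ_three, Derivation.leibniz_pow, pderiv_X]
  simp only [div_eq_mul_inv, map_mul, map_ofNat C]
  ring
end
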